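/- Let k be a field of positive characteristic p and H a finite-dimensional Hopf algebra over k with bijective antipode. Then exp(H) is finite. -/

import Mathlib

open TensorProduct

noncomputable section

variable (k H : Type*) [CommSemiring k] [Semiring H] [Bialgebra k H]

/-- Convolution product of two linear endomorphisms of a bialgebra:
`(f ⋆ g)(x) = ∑ f(x⁽¹⁾) g(x⁽²⁾)`, i.e. `m ∘ (f ⊗ g) ∘ Δ`. -/
def conv (f g : H →ₗ[k] H) : H →ₗ[k] H :=
  LinearMap.mul' k H ∘ₗ TensorProduct.map f g ∘ₗ Coalgebra.comul

/-- `expMap k H Sinv n` is the map `m_n ∘ (id ⊗ Sinv² ⊗ Sinv⁴ ⊗ ⋯ ⊗ Sinv^{2n-2}) ∘ Δ_n`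
(defined by the recursion `m_1 = Δ_1 = id`, `m_n = m ∘ (m_{n-1} ⊗ id)`,
`Δ_n = (Δ_{n-1} ⊗ id) ∘ Δ`). -/
def expMap (Sinv : H →ₗ[k] H) : ℕ → (H →ₗ[k] H)
  | 0 => 0
  | 1 => LinearMap.id
  | (n+2) => conv k H (expMap Sinv (n+1)) ((Sinv ∘ₗ Sinv) ^ (n+1))

/-- The map `x ↦ ε(x)·1`. -/
def counitUnit : H →ₗ[k] H := Algebra.linearMap k H ∘ₗ Coalgebra.counit

/-- The exponent of a Hopf algebra (with `Sinv` the inverse of the antipode):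
the least `n > 0` with `m_n ∘ (id ⊗ S⁻² ⊗ ⋯ ⊗ S^{-2n+2}) ∘ Δ_n = ε(·)1`.
By convention `hopfExponent = 0` when no such `n` exists (i.e. `exp(H) = ∞`). -/
def hopfExponent (Sinv : H →ₗ[k] H) : ℕ :=
  sInf {n : ℕ | 0 < n ∧ expMap k H Sinv n = counitUnit k H}


section P1
open Coalgebra HopfAlgebra

variable {K H : Type*} [Field K] [Ring H] [HopfAlgebra K H]

structure IsCoact {C : Type*} [AddCommGroup C] [Module K C] (δ : C →ₗ[K] C ⊗[K] H) : Prop where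
  assoc : ∀ c, TensorProduct.assoc K C H H (δ.rTensor H (δ c)) = (comul (R := K) (A := H)).lTensor C (δ c)
  counit : ∀ c, (counit (R := K) (A := H)).lTensor C (δ c) = c ⊗ₜ 1

structure IsAct {M : Type*} [AddCommGroup M] [Module K M] (a : M →ₗ[K] H →ₗ[K] M) : Prop where
  one : ∀ m, a m 1 = m
  mul : ∀ m x y, a m (x * y) = a (a m x) y

structure IsCoef {ι : Type*} [Fintype ι] [DecidableEq ι] (h : ι → ι → H) : Prop where
  cm : ∀ i j, comul (R := K) (h i j) = ∑ k, h i k ⊗ₜ[K] h k j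
  cu : ∀ i j, counit (R := K) (h i j) = if i = j then 1 else 0

theorem exists_expand {C W ι : Type*} [AddCommGroup C] [Module K C] [AddCommGroup W] [Module K W]
    [Fintype ι] (b : Module.Basis ι K C) (t : C ⊗[K] W) : ∃ w : ι → W, t = ∑ i, b i ⊗ₜ w i := by
  obtain ⟨c, hc⟩ := TensorProduct.eq_repr_basis_left b t
  refine ⟨c, ?_⟩
  rw [← hc, Finsupp.sum_fintype _ _ (by simp)]

theorem expand_inj {C W ι : Type*} [AddCommGroup C] [Module K C] [AddCommGroup W] [Module K W]
    [Fintype ι] (b : Module.Basis ι K C) (w w' : ι → W)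
    (h : ∑ i, b i ⊗ₜ[K] w i = ∑ i, b i ⊗ₜ w' i) : w = w' := by
  classical
  ext j
  have := congrArg (fun t => TensorProduct.lid K W ((b.coord j).rTensor W t)) h
  simpa [Finsupp.single_apply, ite_smul] using this

theorem exists_coef {C ι : Type*} [AddCommGroup C] [Module K C] [Fintype ι] [DecidableEq ι]
    {δ : C →ₗ[K] C ⊗[K] H} (hδ : IsCoact δ) (b : Module.Basis ι K C) :
    ∃ h : ι → ι → H, (∀ j, δ (b j) = ∑ i, b i ⊗ₜ h i j) ∧ IsCoef (K := K) h := by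
  choose h' hh using fun j => exists_expand b (δ (b j))
  refine ⟨fun i j => h' j i, hh, ⟨fun i j => ?_, fun i j => ?_⟩⟩
  · have h1 := hδ.assoc (b j)
    rw [hh j] at h1
    simp only [map_sum, LinearMap.rTensor_tmul, LinearMap.lTensor_tmul, hh, sum_tmul,
      TensorProduct.assoc_tmul] at h1
    rw [Finset.sum_comm] at h1
    simp only [← tmul_sum] at h1
    exact (congrFun (expand_inj b _ _ h1) i).symm
  · have h1 := hδ.counit (b j)
    rw [hh j] at h1
    simp only [map_sum, LinearMap.lTensor_tmul] at h1
    have h2 : b j ⊗ₜ[K] (1:K) = ∑ i, b i ⊗ₜ[K] (if i = j then (1:K) else 0) := by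
      rw [Finset.sum_eq_single j] <;> simp +contextual
    exact congrFun (expand_inj b _ _ (h1.trans h2)) i

theorem isCoact_comul : IsCoact (K := K) (H := H) (comul (R := K) (A := H)) :=
  ⟨fun c => coassoc_apply c, fun c => lTensor_counit_comul c⟩

section coef
variable {ι : Type*} [Fintype ι] [DecidableEq ι] {h : ι → ι → H} (hh : IsCoef (K := K) h)
include hh

theorem IsCoef.S_mul (i j) : ∑ k, antipode K (h i k) * h k j = if i = j then 1 else 0 := by
  have := mul_antipode_rTensor_comul_apply (R := K) (h i j)
  simp only [hh.cm, hh.cu, map_sum, LinearMap.rTensor_tmul, LinearMap.mul'_apply] at this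
  rw [this]; split_ifs <;> simp

theorem IsCoef.mul_S (i j) : ∑ k, h i k * antipode K (h k j) = if i = j then 1 else 0 := by
  have := mul_antipode_lTensor_comul_apply (R := K) (h i j)
  simp only [hh.cm, hh.cu, map_sum, LinearMap.lTensor_tmul, LinearMap.mul'_apply] at this
  rw [this]; split_ifs <;> simp

theorem IsCoef.cm_S (i j) : comul (R := K) (antipode K (h i j)) =
    ∑ k, antipode K (h k j) ⊗ₜ[K] antipode K (h i k) := by
  let X : Matrix ι ι (H ⊗[K] H) := Matrix.of fun i j => comul (R := K) (h i j)
  let Y : Matrix ι ι (H ⊗[K] H) := Matrix.of fun i j => comul (R := K) (antipode K (h i j))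
  let Z : Matrix ι ι (H ⊗[K] H) := Matrix.of fun i j =>
    ∑ k, antipode K (h k j) ⊗ₜ[K] antipode K (h i k)
  have h1 : Y * X = 1 := by
    ext i j
    simp only [Matrix.mul_apply, X, Y, Matrix.of_apply, ← Bialgebra.comul_mul, ← map_sum, hh.S_mul,
      Matrix.one_apply]
    split_ifs <;> simp
  have h2 : X * Z = 1 := by
    ext i l
    simp only [Matrix.mul_apply, X, Z, Matrix.of_apply, hh.cm, Finset.sum_mul_sum,
      Algebra.TensorProduct.tmul_mul_tmul]
    have : ∀ j, ∑ m, ∑ k, (h i m * antipode K (h k l)) ⊗ₜ[K] (h m j * antipode K (h j k)) =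
      ∑ m, ∑ k, (h i m * antipode K (h k l)) ⊗ₜ[K] (h m j * antipode K (h j k)) := fun _ => rfl
    rw [Finset.sum_comm]
    simp_rw [Finset.sum_comm (s := Finset.univ (α := ι)) (t := Finset.univ (α := ι))
      (f := fun j k => (h i _ * antipode K (h k l)) ⊗ₜ[K] (h _ j * antipode K (h j k)))]
    simp only [← tmul_sum, hh.mul_S, tmul_ite, tmul_zero, Finset.sum_ite_eq, Finset.mem_univ, if_true,
      ← sum_tmul, Matrix.one_apply]
    split_ifs <;> simp [Algebra.TensorProduct.one_def]
  have := left_inv_eq_right_inv h1 h2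
  exact congrFun (congrFun this i) j

end coef

section inv
variable (Sinv : H →ₗ[K] H)
    (hS1 : Sinv ∘ₗ antipode (R := K) (A := H) = LinearMap.id)
    (hS2 : antipode (R := K) (A := H) ∘ₗ Sinv = LinearMap.id)
include hS1 hS2

theorem S_Sinv (x : H) : antipode K (Sinv x) = x := LinearMap.congr_fun hS2 x
theorem Sinv_S (x : H) : Sinv (antipode K x) = x := LinearMap.congr_fun hS1 x
theorem S_inj : Function.Injective (antipode (R := K) (A := H)) :=
  Function.LeftInverse.injective (Sinv_S Sinv hS1 hS2)
theorem Sinv_mul (x y : H) : Sinv (x * y) = Sinv y * Sinv x := by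
  apply S_inj Sinv hS1 hS2
  rw [antipode_mul_antidistrib]; simp only [S_Sinv Sinv hS1 hS2]
theorem Sinv_one : Sinv 1 = 1 := by
  apply S_inj Sinv hS1 hS2
  rw [S_Sinv Sinv hS1 hS2, antipode_one]

variable {ι : Type*} [Fintype ι] [DecidableEq ι] {h : ι → ι → H} (hh : IsCoef (K := K) h)
include hh

theorem IsCoef.mul_Sinv (i j) : ∑ k, h k j * Sinv (h i k) = if i = j then 1 else 0 := by
  have := congrArg Sinv (hh.mul_S i j)
  simp only [map_sum, Sinv_mul Sinv hS1 hS2, Sinv_S Sinv hS1 hS2] at this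
  rw [this]; split_ifs <;> simp [Sinv_one Sinv hS1 hS2]

theorem IsCoef.Sinv_mul (i j) : ∑ k, Sinv (h k j) * h i k = if i = j then 1 else 0 := by
  have := congrArg Sinv (hh.S_mul i j)
  simp only [map_sum, _root_.Sinv_mul Sinv hS1 hS2, Sinv_S Sinv hS1 hS2] at this
  rw [this]; split_ifs <;> simp [Sinv_one Sinv hS1 hS2]

end inv

theorem comul_antipode [FiniteDimensional K H] (x : H) : comul (R := K) (antipode K x) =
    TensorProduct.map (antipode K) (antipode K) (TensorProduct.comm K H H (comul (R := K) x)) := by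
  classical
  obtain ⟨g, hg, hc⟩ := exists_coef (isCoact_comul (K := K) (H := H)) (Module.finBasis K H)
  have hx : ∀ i j, comul (R := K) (antipode K (g i j)) =
    TensorProduct.map (antipode K) (antipode K) (TensorProduct.comm K H H (comul (R := K) (g i j))) := by
    intro i j
    rw [hc.cm_S, hc.cm]; simp
  -- basis elements are combinations of the coefficients
  have hb : ∀ j, Module.finBasis K H j = ∑ i, counit (R := K) (Module.finBasis K H i) • g i j := by
    intro j
    have := congrArg (TensorProduct.lid K H) (rTensor_counit_comul (R := K) (Module.finBasis K H j))
    rw [hg] at this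
    simpa using this.symm
  have := (Module.finBasis K H).ext (f₁ := comul (R := K) ∘ₗ antipode K)
    (f₂ := TensorProduct.map (antipode K) (antipode K) ∘ₗ (TensorProduct.comm K H H).toLinearMap ∘ₗ
      comul (R := K)) (fun j => by
        rw [hb j]
        simp only [map_sum, map_smul, LinearMap.comp_apply, hx, LinearEquiv.coe_coe])
  exact LinearMap.congr_fun this x

theorem comul_Sinv [FiniteDimensional K H] (Sinv : H →ₗ[K] H)
    (hS1 : Sinv ∘ₗ antipode (R := K) (A := H) = LinearMap.id)
    (hS2 : antipode (R := K) (A := H) ∘ₗ Sinv = LinearMap.id) (x : H) : comul (R := K) (Sinv x) =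
    TensorProduct.map Sinv Sinv (TensorProduct.comm K H H (comul (R := K) x)) := by
  have h := comul_antipode (K := K) (Sinv x)
  rw [S_Sinv Sinv hS1 hS2] at h
  rw [h]
  generalize comul (R := K) (Sinv x) = t
  induction t using TensorProduct.induction_on with
  | zero => simp
  | tmul a b => simp [Sinv_S Sinv hS1 hS2]
  | add a b ha hb => rw [map_add, map_add, map_add, map_add, ← ha, ← hb]
end P1


section L1

structure TopD {K V : Type*} [Field K] [AddCommGroup V] [Module K V] (T : V →ₗ[K] V) (q : ℕ)
    (L : K → ℚ) where
  n : ℕ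
  b : Module.Basis (Fin n) K V
  t : Fin n → K
  ht : ∀ i, t i ≠ 0
  eig : ∀ i, (T ^ q) (b i) = t i • b i
  M : ℚ
  le : ∀ i, L (t i) ≤ M
  ex : ∃ i, L (t i) = M

namespace TopD
variable {K V W : Type*} [Field K] [AddCommGroup V] [Module K V] [AddCommGroup W] [Module K W]
  {T : V →ₗ[K] V} {T' : W →ₗ[K] W} {q : ℕ} {L : K → ℚ}

abbrev J (d : TopD T q L) := {i : Fin d.n // L (d.t i) = d.M}

noncomputable def pr (d : TopD T q L) : V →ₗ[K] (d.J → K) :=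
  LinearMap.pi fun j => d.b.coord j.1

noncomputable def inc (d : TopD T q L) : (d.J → K) →ₗ[K] V :=
  (Pi.basisFun K d.J).constr K fun j => d.b j.1

theorem inc_single (d : TopD T q L) (j : d.J) : d.inc (Pi.single j 1) = d.b j.1 := by
  have := (Pi.basisFun K d.J).constr_basis K (fun j => d.b j.1) j
  rwa [Pi.basisFun_apply] at this

theorem pr_top (d : TopD T q L) (j : d.J) : d.pr (d.b j.1) = Pi.single j 1 := by
  ext k
  simp [pr, Finsupp.single_apply, Pi.single_apply, Subtype.ext_iff, eq_comm]

theorem pr_not (d : TopD T q L) (i) (hi : L (d.t i) ≠ d.M) : d.pr (d.b i) = 0 := by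
  ext k
  have : i ≠ k.1 := fun h => hi (h ▸ k.2)
  simp [pr, Finsupp.single_apply, this]

theorem pr_inc (d : TopD T q L) : d.pr ∘ₗ d.inc = LinearMap.id := by
  apply (Pi.basisFun K d.J).ext
  intro j
  simp [inc_single, pr_top]

/-- descended operator on a single space -/
noncomputable def D1 (d : TopD T q L) (F : V →ₗ[K] V) : (d.J → K) →ₗ[K] (d.J → K) :=
  d.pr ∘ₗ F ∘ₗ d.inc

noncomputable def P2 (d : TopD T q L) (e : TopD T' q L) : V ⊗[K] W →ₗ[K] (d.J → K) ⊗[K] (e.J → K) :=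
  TensorProduct.map d.pr e.pr
noncomputable def I2 (d : TopD T q L) (e : TopD T' q L) : (d.J → K) ⊗[K] (e.J → K) →ₗ[K] V ⊗[K] W :=
  TensorProduct.map d.inc e.inc
noncomputable def D2 (d : TopD T q L) (e : TopD T' q L) (F : V ⊗[K] W →ₗ[K] V ⊗[K] W) :
    (d.J → K) ⊗[K] (e.J → K) →ₗ[K] (d.J → K) ⊗[K] (e.J → K) :=
  P2 d e ∘ₗ F ∘ₗ I2 d e

theorem P2_I2 (d : TopD T q L) (e : TopD T' q L) : P2 d e ∘ₗ I2 d e = LinearMap.id := by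
  rw [P2, I2, ← TensorProduct.map_comp, pr_inc, pr_inc, TensorProduct.map_id]

theorem D1_pr (d : TopD T q L) (F : V →ₗ[K] V) (hF : F ∘ₗ T = T ∘ₗ F) :
    d.D1 F ∘ₗ d.pr = d.pr ∘ₗ F := by
  have hc : ∀ x, F ((T ^ q) x) = (T ^ q) (F x) := by
    intro x
    have : Commute F T := hF
    exact LinearMap.congr_fun (this.pow_right q).eq x
  apply d.b.ext
  intro i
  by_cases hi : L (d.t i) = d.M
  · have := d.pr_top ⟨i, hi⟩
    have h2 := d.inc_single ⟨i, hi⟩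
    simp only at this h2
    simp [D1, this, h2]
  · simp only [D1, LinearMap.comp_apply, d.pr_not i hi, map_zero]
    symm
    ext k
    simp only [pr, LinearMap.pi_apply, Pi.zero_apply]
    have h1 := congrArg (fun x => d.b.coord k.1 x) (hc (d.b i))
    simp only [d.eig, map_smul] at h1
    have h3 : d.b.coord k.1 ∘ₗ (T ^ q) = d.t k.1 • d.b.coord k.1 := by
      apply d.b.ext
      intro j
      simp only [LinearMap.comp_apply, d.eig, map_smul, LinearMap.smul_apply, Module.Basis.coord_apply,
        Module.Basis.repr_self, Finsupp.single_apply, smul_eq_mul]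
      split_ifs with h
      · rw [h]
      · simp
    have h4 := LinearMap.congr_fun h3 (F (d.b i))
    simp only [LinearMap.comp_apply, LinearMap.smul_apply] at h4
    rw [h4] at h1
    simp only [smul_eq_mul] at h1
    have h5 : (d.t i - d.t k.1) * d.b.coord k.1 (F (d.b i)) = 0 := by linear_combination h1
    rcases mul_eq_zero.1 h5 with h | h
    · exact absurd k.2 (by rw [← sub_eq_zero.1 h]; exact hi)
    · exact h

theorem D2_P2 (d : TopD T q L) (e : TopD T' q L)
    (hL : ∀ x y : K, x ≠ 0 → y ≠ 0 → L (x * y) = L x + L y)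
    (F : V ⊗[K] W →ₗ[K] V ⊗[K] W)
    (hF : F ∘ₗ TensorProduct.map T T' = TensorProduct.map T T' ∘ₗ F) :
    D2 d e F ∘ₗ P2 d e = P2 d e ∘ₗ F := by
  have hc : ∀ x, F (TensorProduct.map (T ^ q) (T' ^ q) x) = TensorProduct.map (T ^ q) (T' ^ q) (F x) := by
    intro x
    have : Commute F (TensorProduct.map T T') := hF
    have := (this.pow_right q).eq
    rw [TensorProduct.map_pow] at this
    exact LinearMap.congr_fun this x
  apply (d.b.tensorProduct e.b).ext
  rintro ⟨i, j⟩
  rw [Module.Basis.tensorProduct_apply]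
  by_cases hij : L (d.t i) = d.M ∧ L (e.t j) = e.M
  · have h1 := d.pr_top ⟨i, hij.1⟩
    have h2 := d.inc_single ⟨i, hij.1⟩
    have h3 := e.pr_top ⟨j, hij.2⟩
    have h4 := e.inc_single ⟨j, hij.2⟩
    simp only at h1 h2 h3 h4
    simp [D2, P2, I2, h1, h2, h3, h4]
  · have h0 : P2 d e (d.b i ⊗ₜ e.b j) = 0 := by
      rw [P2, TensorProduct.map_tmul]
      by_cases hi : L (d.t i) = d.M
      · rw [e.pr_not j (fun h => hij ⟨hi, h⟩), tmul_zero]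
      · rw [d.pr_not i hi, zero_tmul]
    simp only [D2, LinearMap.comp_apply, h0, map_zero]
    set B := d.b.tensorProduct e.b with hB
    set x := F (d.b i ⊗ₜ e.b j) with hx
    have hxs : x = ∑ kl, B.repr x kl • (d.b kl.1 ⊗ₜ e.b kl.2) := by
      conv_lhs => rw [← B.sum_repr x]
      simp [hB, Module.Basis.tensorProduct_apply']
    rw [hxs, map_sum, eq_comm]
    apply Finset.sum_eq_zero
    rintro ⟨k, l⟩ -
    rw [map_smul]
    by_cases hk : L (d.t k) = d.M
    swap
    · rw [P2, TensorProduct.map_tmul, d.pr_not k hk, zero_tmul, smul_zero]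
    by_cases hl : L (e.t l) = e.M
    swap
    · rw [P2, TensorProduct.map_tmul, e.pr_not l hl, tmul_zero, smul_zero]
    have h1 := hc (d.b i ⊗ₜ e.b j)
    rw [TensorProduct.map_tmul, d.eig, e.eig, TensorProduct.smul_tmul_smul, map_smul, ← hx] at h1
    have h3 : B.coord (k, l) ∘ₗ TensorProduct.map (T ^ q) (T' ^ q) = (d.t k * e.t l) • B.coord (k, l) := by
      apply B.ext
      rintro ⟨a, c⟩
      have : B.coord (k, l) (d.b a ⊗ₜ e.b c) = if (a, c) = (k, l) then 1 else 0 := by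
        rw [← Module.Basis.tensorProduct_apply, ← hB, Module.Basis.coord_apply, Module.Basis.repr_self,
          Finsupp.single_apply]
      rw [LinearMap.comp_apply, hB, Module.Basis.tensorProduct_apply, TensorProduct.map_tmul, d.eig, e.eig,
        TensorProduct.smul_tmul_smul, map_smul, LinearMap.smul_apply, this]
      split_ifs with h
      · simp only [Prod.mk.injEq] at h
        rw [h.1, h.2]
      · simp
    have h4 := LinearMap.congr_fun h3 x
    simp only [LinearMap.comp_apply, LinearMap.smul_apply] at h4
    rw [← h1, map_smul, smul_eq_mul, smul_eq_mul] at h4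
    have h5 : (d.t i * e.t j - d.t k * e.t l) * B.coord (k, l) x = 0 := by linear_combination h4
    rcases mul_eq_zero.1 h5 with h | h
    · exfalso
      have h6 := congrArg L (sub_eq_zero.1 h)
      rw [hL _ _ (d.ht i) (e.ht j), hL _ _ (d.ht k) (e.ht l), hk, hl] at h6
      have := d.le i
      have := e.le j
      exact hij ⟨by linarith, by linarith⟩
    · rw [Module.Basis.coord_apply] at h
      rw [h, zero_smul]
end TopD
end L1


section L2

theorem det_rTensor_pow {K V W : Type*} [Field K] [AddCommGroup V] [Module K V] [AddCommGroup W] [Module K W]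
    [FiniteDimensional K V] [FiniteDimensional K W] (F : V →ₗ[K] V) :
    LinearMap.det (F.rTensor W) = LinearMap.det F ^ Module.finrank K W := by
  classical
  let b := Module.finBasis K V
  let c := Module.finBasis K W
  rw [← LinearMap.det_toMatrix (b.tensorProduct c), LinearMap.rTensor, TensorProduct.toMatrix_map,
    Matrix.det_kronecker, LinearMap.det_toMatrix, LinearMap.toMatrix_id, Matrix.det_one, one_pow, mul_one,
    Fintype.card_fin]

theorem exists_log {K : Type*} [Field K] (x : K) (hx : x ≠ 0) (hr : ∀ n : ℕ, 0 < n → x ^ n ≠ 1) :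
    ∃ L : K → ℚ, (∀ x y : K, x ≠ 0 → y ≠ 0 → L (x * y) = L x + L y) ∧ 0 < L x := by
  classical
  let ux : Kˣ := Units.mk0 x hx
  let f : ℤ →+ Additive Kˣ := 
    { toFun := fun n => Additive.ofMul (ux ^ n)
      map_zero' := by simp
      map_add' := fun a b => by rw [zpow_add, ofMul_mul] }
  have hf : ∀ n : ℤ, f n = Additive.ofMul (ux ^ n) := fun n => rfl
  have hinj : Function.Injective f := by
    intro a b hab
    rw [hf, hf] at hab
    have h1 : ux ^ a = ux ^ b := hab
    have h2 : ¬ IsOfFinOrder ux := by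
      rw [isOfFinOrder_iff_pow_eq_one]
      rintro ⟨n, hn, h⟩
      apply hr n hn
      have := congrArg Units.val h
      simpa [ux] using this
    exact injective_zpow_iff_not_isOfFinOrder.2 h2 h1
  obtain ⟨h, hh⟩ := (Module.Baer.of_divisible ℚ).extension_property_addMonoidHom f hinj
    (Int.castAddHom ℚ)
  refine ⟨fun y => if hy : y = 0 then 0 else h (Additive.ofMul (Units.mk0 y hy)), ?_, ?_⟩
  · intro a b ha hb
    simp only [ha, hb, mul_eq_zero, or_self, dif_neg, not_false_iff]
    rw [← map_add, ← ofMul_mul, Units.mk0_mul]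
  · have := DFunLike.congr_fun hh 1
    simp only [AddMonoidHom.comp_apply, hf, zpow_one] at this
    simp only [hx, dif_neg, not_false_iff]
    rw [show Units.mk0 x hx = ux from rfl, this]
    simp

theorem exists_eigenbasis {K V : Type*} [Field K] [IsAlgClosed K] [AddCommGroup V] [Module K V]
    [FiniteDimensional K V] [Nontrivial V] (p : ℕ) [Fact p.Prime] [CharP K p] (T : V →ₗ[K] V)
    (hT : Function.Injective T) :
    ∃ m0 : ℕ, ∀ m ≥ m0, ∃ (n : ℕ) (b : Module.Basis (Fin n) K V) (t : Fin n → K),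
      (∀ i, t i ≠ 0) ∧ ∀ i, (T ^ p ^ m) (b i) = t i • b i := by
  classical
  obtain ⟨n, hn, s, hs, hnil, hss, hTe⟩ := Module.End.exists_isNilpotent_isSemisimple (K := K) (f := T)
  have hcomm : Commute n s := by
    have h1 : Commute T s := (Algebra.commute_of_mem_adjoin_self hs)
    have : Commute (n + s) s := hTe ▸ h1
    simpa using this.sub_left (Commute.refl s)
  obtain ⟨m0, hm0⟩ := hnil
  refine ⟨m0, fun m hm => ?_⟩
  haveI : CharP (Module.End K V) p :=
    charP_of_injective_algebraMap (algebraMap K (Module.End K V)).injective p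
  have hpow : T ^ p ^ m = s ^ p ^ m := by
    rw [hTe, add_pow_char_pow_of_commute _ _ hcomm]
    have : n ^ p ^ m = 0 := pow_eq_zero_of_le
      (hm.trans (Nat.lt_pow_self (Fact.out : p.Prime).one_lt).le) hm0
    rw [this, zero_add]
  let X : Set V := {v | ∃ μ : K, s v = μ • v}
  have hX : Submodule.span K X = ⊤ := by
    rw [eq_top_iff, ← hss.iSup_eigenspace_eq_top]
    refine iSup_le fun μ v hv => Submodule.subset_span ⟨μ, Module.End.mem_eigenspace_iff.1 hv⟩
  obtain ⟨B, hBX, hBs, hBl⟩ := exists_linearIndependent K X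
  let b0 : Module.Basis B K V := Module.Basis.mk hBl (by rw [Subtype.range_coe, hBs, hX])
  haveI : Finite B := hBl.finite
  haveI := Fintype.ofFinite B
  let b := b0.reindex (Fintype.equivFin B)
  have hb : ∀ i, ∃ μ : K, s (b i) = μ • b i := by
    intro i
    have : b i ∈ X := by
      simp only [b, b0, Module.Basis.reindex_apply, Module.Basis.mk_apply]
      exact hBX (Subtype.coe_prop _)
    exact this
  choose μ hμ using hb
  have hpw : ∀ N i, (s ^ N) (b i) = μ i ^ N • b i := by
    intro N i
    induction N with
    | zero => simp
    | succ N ih => rw [pow_succ', Module.End.mul_apply, ih, map_smul, hμ, smul_smul, pow_succ]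
  have hTi : ∀ N, Function.Injective (T ^ N : Module.End K V) := by
    intro N
    rw [Module.End.coe_pow]
    exact hT.iterate N
  refine ⟨_, b, fun i => μ i ^ p ^ m, fun i h0 => ?_, fun i => by rw [hpow, hpw]⟩
  replace h0 : μ i ^ p ^ m = 0 := h0
  have h1 : (T ^ p ^ m) (b i) = 0 := by rw [hpow, hpw, h0, zero_smul]
  exact b.ne_zero i (hTi _ (by rw [h1, map_zero]))

section legs
variable {K : Type*} [Field K]

noncomputable def F12 {C M : Type*} (N : Type*) [AddCommGroup C] [Module K C] [AddCommGroup M] [Module K M]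
    [AddCommGroup N] [Module K N]
    (F : C ⊗[K] M →ₗ[K] C ⊗[K] M) : (C ⊗[K] M) ⊗[K] N →ₗ[K] (C ⊗[K] M) ⊗[K] N := F.rTensor N

noncomputable def F13 {C N : Type*} (M : Type*) [AddCommGroup C] [Module K C] [AddCommGroup M] [Module K M]
    [AddCommGroup N] [Module K N]
    (F : C ⊗[K] N →ₗ[K] C ⊗[K] N) : (C ⊗[K] M) ⊗[K] N →ₗ[K] (C ⊗[K] M) ⊗[K] N :=
  (TensorProduct.rightComm K C N M).toLinearMap ∘ₗ F.rTensor M ∘ₗ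
    (TensorProduct.rightComm K C M N).toLinearMap

noncomputable def F23 {M N : Type*} (C : Type*) [AddCommGroup C] [Module K C] [AddCommGroup M] [Module K M]
    [AddCommGroup N] [Module K N]
    (F : M ⊗[K] N →ₗ[K] M ⊗[K] N) : (C ⊗[K] M) ⊗[K] N →ₗ[K] (C ⊗[K] M) ⊗[K] N :=
  (TensorProduct.assoc K C M N).symm.toLinearMap ∘ₗ F.lTensor C ∘ₗ
    (TensorProduct.assoc K C M N).toLinearMap

variable {C M N C' M' N' : Type*} [AddCommGroup C] [Module K C] [AddCommGroup M] [Module K M]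
    [AddCommGroup N] [Module K N] [AddCommGroup C'] [Module K C'] [AddCommGroup M'] [Module K M']
    [AddCommGroup N'] [Module K N']

theorem det_F12 [FiniteDimensional K C] [FiniteDimensional K M] [FiniteDimensional K N]
    (F : C ⊗[K] M →ₗ[K] C ⊗[K] M) : LinearMap.det (F12 N F) = LinearMap.det F ^ Module.finrank K N :=
  det_rTensor_pow F

theorem det_F13_ne [FiniteDimensional K C] [FiniteDimensional K M] [FiniteDimensional K N]
    (F : C ⊗[K] N →ₗ[K] C ⊗[K] N) (hF : LinearMap.det F ≠ 0) : LinearMap.det (F13 M F) ≠ 0 := by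
  have := LinearMap.det_conj (F.rTensor M) (TensorProduct.rightComm K C N M)
  rw [TensorProduct.rightComm_symm] at this
  rw [F13, this, det_rTensor_pow]
  exact pow_ne_zero _ hF

theorem det_F23_ne [FiniteDimensional K C] [FiniteDimensional K M] [FiniteDimensional K N]
    (F : M ⊗[K] N →ₗ[K] M ⊗[K] N) (hF : LinearMap.det F ≠ 0) : LinearMap.det (F23 C F) ≠ 0 := by
  have := LinearMap.det_conj (F.lTensor C) (TensorProduct.assoc K C M N).symm
  rw [LinearEquiv.symm_symm] at this
  rw [F23, this]
  have h2 := LinearMap.det_conj (F.rTensor C) (TensorProduct.comm K (M ⊗[K] N) C)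
  have h3 : (TensorProduct.comm K (M ⊗[K] N) C).toLinearMap ∘ₗ F.rTensor C ∘ₗ
    (TensorProduct.comm K (M ⊗[K] N) C).symm.toLinearMap = F.lTensor C := by
    ext c x
    simp
  rw [← h3, h2, det_rTensor_pow]
  exact pow_ne_zero _ hF

variable {f : C →ₗ[K] C'} {g : M →ₗ[K] M'} {h : N →ₗ[K] N'}

theorem F12_desc {F : C ⊗[K] M →ₗ[K] C ⊗[K] M} {F' : C' ⊗[K] M' →ₗ[K] C' ⊗[K] M'}
    (hF : F' ∘ₗ TensorProduct.map f g = TensorProduct.map f g ∘ₗ F) :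
    F12 N' F' ∘ₗ TensorProduct.map (TensorProduct.map f g) h =
      TensorProduct.map (TensorProduct.map f g) h ∘ₗ F12 N F := by
  rw [F12, F12, LinearMap.rTensor, LinearMap.rTensor, ← TensorProduct.map_comp, ← TensorProduct.map_comp,
    hF, LinearMap.id_comp, LinearMap.comp_id]

theorem rightComm_nat (x) : TensorProduct.rightComm K C' M' N' (TensorProduct.map (TensorProduct.map f g) h x) =
    TensorProduct.map (TensorProduct.map f h) g (TensorProduct.rightComm K C M N x) := by
  have : (TensorProduct.rightComm K C' M' N').toLinearMap ∘ₗ (TensorProduct.map (TensorProduct.map f g) h) =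
    TensorProduct.map (TensorProduct.map f h) g ∘ₗ (TensorProduct.rightComm K C M N).toLinearMap := by
    ext; simp
  exact LinearMap.congr_fun this x

theorem F13_desc {F : C ⊗[K] N →ₗ[K] C ⊗[K] N} {F' : C' ⊗[K] N' →ₗ[K] C' ⊗[K] N'}
    (hF : F' ∘ₗ TensorProduct.map f h = TensorProduct.map f h ∘ₗ F) :
    F13 M' F' ∘ₗ TensorProduct.map (TensorProduct.map f g) h =
      TensorProduct.map (TensorProduct.map f g) h ∘ₗ F13 M F := by
  have := F12_desc (h := g) hF
  apply LinearMap.ext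
  intro x
  simp only [F13, LinearMap.comp_apply, LinearEquiv.coe_coe, rightComm_nat]
  have h2 := LinearMap.congr_fun this (TensorProduct.rightComm K C M N x)
  simp only [F12, LinearMap.comp_apply] at h2
  rw [h2, rightComm_nat]

theorem F23_desc {F : M ⊗[K] N →ₗ[K] M ⊗[K] N} {F' : M' ⊗[K] N' →ₗ[K] M' ⊗[K] N'}
    (hF : F' ∘ₗ TensorProduct.map g h = TensorProduct.map g h ∘ₗ F) :
    F23 C' F' ∘ₗ TensorProduct.map (TensorProduct.map f g) h =
      TensorProduct.map (TensorProduct.map f g) h ∘ₗ F23 C F := by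
  have : F'.lTensor C' ∘ₗ TensorProduct.map f (TensorProduct.map g h) =
      TensorProduct.map f (TensorProduct.map g h) ∘ₗ F.lTensor C := by
    rw [LinearMap.lTensor, LinearMap.lTensor, ← TensorProduct.map_comp, ← TensorProduct.map_comp,
      hF, LinearMap.id_comp, LinearMap.comp_id]
  apply LinearMap.ext
  intro x
  simp only [F23, LinearMap.comp_apply, LinearEquiv.coe_coe, ← TensorProduct.map_map_assoc]
  have h2 := LinearMap.congr_fun this (TensorProduct.assoc K C M N x)
  simp only [LinearMap.comp_apply] at h2
  rw [h2, TensorProduct.map_map_assoc_symm]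
end legs
end L2


section L3

structure Sys {K V H : Type*} [Field K] [AddCommGroup V] [Module K V] [AddCommGroup H] [Module K H]
    (u : V →ₗ[K] V) (σ : H →ₗ[K] H) where
  AVH : V ⊗[K] H →ₗ[K] V ⊗[K] H
  BV : V ⊗[K] H →ₗ[K] V ⊗[K] H
  QV : V ⊗[K] H →ₗ[K] V ⊗[K] H
  FV : V ⊗[K] H →ₗ[K] V ⊗[K] H
  GV : V ⊗[K] H →ₗ[K] V ⊗[K] H
  AHV : H ⊗[K] V →ₗ[K] H ⊗[K] V
  AHH : H ⊗[K] H →ₗ[K] H ⊗[K] H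
  BH : H ⊗[K] H →ₗ[K] H ⊗[K] H
  QH : H ⊗[K] H →ₗ[K] H ⊗[K] H
  FH : H ⊗[K] H →ₗ[K] H ⊗[K] H
  GH : H ⊗[K] H →ₗ[K] H ⊗[K] H
  cAVH : AVH ∘ₗ TensorProduct.map u σ = TensorProduct.map u σ ∘ₗ AVH
  cBV : BV ∘ₗ TensorProduct.map u σ = TensorProduct.map u σ ∘ₗ BV
  cQV : QV ∘ₗ TensorProduct.map u σ = TensorProduct.map u σ ∘ₗ QV
  cFV : FV ∘ₗ TensorProduct.map u σ = TensorProduct.map u σ ∘ₗ FV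
  cGV : GV ∘ₗ TensorProduct.map u σ = TensorProduct.map u σ ∘ₗ GV
  cAHV : AHV ∘ₗ TensorProduct.map σ u = TensorProduct.map σ u ∘ₗ AHV
  cAHH : AHH ∘ₗ TensorProduct.map σ σ = TensorProduct.map σ σ ∘ₗ AHH
  cBH : BH ∘ₗ TensorProduct.map σ σ = TensorProduct.map σ σ ∘ₗ BH
  cQH : QH ∘ₗ TensorProduct.map σ σ = TensorProduct.map σ σ ∘ₗ QH
  cFH : FH ∘ₗ TensorProduct.map σ σ = TensorProduct.map σ σ ∘ₗ FH
  cGH : GH ∘ₗ TensorProduct.map σ σ = TensorProduct.map σ σ ∘ₗ GH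
  invV : FV ∘ₗ GV = LinearMap.id
  invH : FH ∘ₗ GH = LinearMap.id
  i3V : AVH ∘ₗ FV ∘ₗ BV = FV
  i3H : AHH ∘ₗ FH ∘ₗ BH = FH
  i4V : QV ∘ₗ FV ∘ₗ ((TensorProduct.comm K H V).toLinearMap ∘ₗ AHV ∘ₗ
    (TensorProduct.comm K H V).symm.toLinearMap) = FV
  i4H : QH ∘ₗ FH ∘ₗ ((TensorProduct.comm K H H).toLinearMap ∘ₗ AHH ∘ₗ
    (TensorProduct.comm K H H).symm.toLinearMap) = FH
  i5 : AVH ∘ₗ ((TensorProduct.comm K H V).toLinearMap ∘ₗ AHV ∘ₗ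
    (TensorProduct.comm K H V).symm.toLinearMap) = QV ∘ₗ u.rTensor H ∘ₗ BV
  i1V : F12 H AVH ∘ₗ F13 H AVH ∘ₗ F23 V QH = F23 V QH ∘ₗ F13 H AVH
  i1H : F12 H AHV ∘ₗ F13 V AHH ∘ₗ F23 H QV = F23 H QV ∘ₗ F13 V AHH

namespace TopD
variable {K V W : Type*} [Field K] [AddCommGroup V] [Module K V] [AddCommGroup W] [Module K W]
  {T : V →ₗ[K] V} {T' : W →ₗ[K] W} {q : ℕ} {L : K → ℚ}
  (d : TopD T q L) (e : TopD T' q L)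

theorem D2_comp (F G : V ⊗[K] W →ₗ[K] V ⊗[K] W) (hF : D2 d e F ∘ₗ P2 d e = P2 d e ∘ₗ F) :
    D2 d e (F ∘ₗ G) = D2 d e F ∘ₗ D2 d e G := by
  have : D2 d e F ∘ₗ D2 d e G = (D2 d e F ∘ₗ P2 d e) ∘ₗ G ∘ₗ I2 d e := rfl
  rw [this, hF]; rfl

theorem D2_id : D2 d e LinearMap.id = LinearMap.id := P2_I2 d e

theorem D2_comm (F : W ⊗[K] V →ₗ[K] W ⊗[K] V) :
    D2 d e ((TensorProduct.comm K W V).toLinearMap ∘ₗ F ∘ₗ (TensorProduct.comm K W V).symm.toLinearMap) =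
    (TensorProduct.comm K _ _).toLinearMap ∘ₗ D2 e d F ∘ₗ (TensorProduct.comm K _ _).symm.toLinearMap := by
  have h1 : P2 d e ∘ₗ (TensorProduct.comm K W V).toLinearMap =
    (TensorProduct.comm K _ _).toLinearMap ∘ₗ P2 e d := by
    apply TensorProduct.ext'; intro x y; simp [P2]
  have h2 : (TensorProduct.comm K W V).symm.toLinearMap ∘ₗ I2 d e =
    I2 e d ∘ₗ (TensorProduct.comm K _ _).symm.toLinearMap := by
    apply TensorProduct.ext'; intro x y; simp [I2]
  have : D2 d e ((TensorProduct.comm K W V).toLinearMap ∘ₗ F ∘ₗ (TensorProduct.comm K W V).symm.toLinearMap)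
    = (P2 d e ∘ₗ (TensorProduct.comm K W V).toLinearMap) ∘ₗ F ∘ₗ
      ((TensorProduct.comm K W V).symm.toLinearMap ∘ₗ I2 d e) := rfl
  rw [this, h1, h2]; rfl

theorem det_D2_comm (F : W ⊗[K] V →ₗ[K] W ⊗[K] V) :
    LinearMap.det (D2 d e ((TensorProduct.comm K W V).toLinearMap ∘ₗ F ∘ₗ
      (TensorProduct.comm K W V).symm.toLinearMap)) = LinearMap.det (D2 e d F) := by
  rw [D2_comm, LinearMap.det_conj]

theorem D2_rTensor (F : V →ₗ[K] V) : D2 d e (F.rTensor W) = (D1 d F).rTensor _ := by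
  apply TensorProduct.ext'
  intro x y
  have := LinearMap.congr_fun (pr_inc e) y
  simp only [LinearMap.comp_apply, LinearMap.id_apply] at this
  simp [D2, P2, I2, D1, this]

theorem det_i1 {X : Type*} [AddCommGroup X] [Module K X] {T'' : X →ₗ[K] X} (f : TopD T'' q L)
    {A : V ⊗[K] W →ₗ[K] V ⊗[K] W} {A2 : V ⊗[K] X →ₗ[K] V ⊗[K] X} {Q : W ⊗[K] X →ₗ[K] W ⊗[K] X}
    (hA : D2 d e A ∘ₗ P2 d e = P2 d e ∘ₗ A)
    (hA2 : D2 d f A2 ∘ₗ P2 d f = P2 d f ∘ₗ A2)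
    (hQ : D2 e f Q ∘ₗ P2 e f = P2 e f ∘ₗ Q)
    (h : F12 X A ∘ₗ F13 W A2 ∘ₗ F23 V Q = F23 V Q ∘ₗ F13 W A2)
    (h2 : LinearMap.det (D2 d f A2) ≠ 0) (h3 : LinearMap.det (D2 e f Q) ≠ 0) :
    LinearMap.det (D2 d e A) ^ Fintype.card f.J = 1 := by
  have e1 := F12_desc (h := f.pr) hA
  have e2 := F13_desc (g := e.pr) hA2
  have e3 := F23_desc (f := d.pr) hQ
  set P3 := TensorProduct.map (TensorProduct.map d.pr e.pr) f.pr with hP3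
  have hsec : P3 ∘ₗ TensorProduct.map (TensorProduct.map d.inc e.inc) f.inc = LinearMap.id := by
    rw [hP3, ← TensorProduct.map_comp, ← TensorProduct.map_comp, pr_inc, pr_inc, pr_inc,
      TensorProduct.map_id, TensorProduct.map_id]
  have hcan : ∀ X Y : (((d.J → K) ⊗[K] (e.J → K)) ⊗[K] (f.J → K)) →ₗ[K]
      (((d.J → K) ⊗[K] (e.J → K)) ⊗[K] (f.J → K)), X ∘ₗ P3 = Y ∘ₗ P3 → X = Y := by
    intro X Y hXY
    have := congrArg (fun Z => Z ∘ₗ TensorProduct.map (TensorProduct.map d.inc e.inc) f.inc) hXY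
    simpa only [LinearMap.comp_assoc, hsec, LinearMap.comp_id] using this
  have key : F12 _ (D2 d e A) ∘ₗ F13 _ (D2 d f A2) ∘ₗ F23 _ (D2 e f Q) =
      F23 _ (D2 e f Q) ∘ₗ F13 _ (D2 d f A2) := by
    apply hcan
    rw [LinearMap.comp_assoc, LinearMap.comp_assoc, e3, ← LinearMap.comp_assoc _ _ (F13 _ _), e2,
      LinearMap.comp_assoc, ← LinearMap.comp_assoc, e1, LinearMap.comp_assoc, h,
      LinearMap.comp_assoc, e2, ← LinearMap.comp_assoc, ← LinearMap.comp_assoc, e3]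
  have hd : LinearMap.det (F12 _ (D2 d e A) ∘ₗ F13 _ (D2 d f A2) ∘ₗ F23 _ (D2 e f Q)) =
      LinearMap.det (F23 _ (D2 e f Q) ∘ₗ F13 _ (D2 d f A2)) := by rw [key]
  rw [LinearMap.det_comp, LinearMap.det_comp, LinearMap.det_comp, det_F12, Module.finrank_fintype_fun_eq_card] at hd
  have n2 := det_F13_ne (M := e.J → K) _ h2
  have n3 := det_F23_ne (C := d.J → K) _ h3
  have : (LinearMap.det (D2 d e A) ^ Fintype.card f.J - 1) *
    (LinearMap.det (F13 (e.J → K) (D2 d f A2)) * LinearMap.det (F23 (d.J → K) (D2 e f Q))) = 0 := by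
    linear_combination hd
  rcases mul_eq_zero.1 this with h | h
  · exact sub_eq_zero.1 h
  · exact absurd h (mul_ne_zero n2 n3)

end TopD

open TopD in
theorem sys_det {K V H : Type*} [Field K] [AddCommGroup V] [Module K V] [AddCommGroup H] [Module K H]
    {u : V →ₗ[K] V} {σ : H →ₗ[K] H} (s : Sys u σ) {q : ℕ} {L : K → ℚ}
    (hL : ∀ x y : K, x ≠ 0 → y ≠ 0 → L (x * y) = L x + L y)
    (d : TopD u q L) (e : TopD σ q L) :
    LinearMap.det (d.D1 u) ^ (Fintype.card e.J * Fintype.card e.J) = 1 := by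
  have cAVH := D2_P2 d e hL _ s.cAVH
  have cBV := D2_P2 d e hL _ s.cBV
  have cQV := D2_P2 d e hL _ s.cQV
  have cFV := D2_P2 d e hL _ s.cFV
  have cAHV := D2_P2 e d hL _ s.cAHV
  have cAHH := D2_P2 e e hL _ s.cAHH
  have cQH := D2_P2 e e hL _ s.cQH
  have cFH := D2_P2 e e hL _ s.cFH
  have cu : D2 d e (u.rTensor H) ∘ₗ P2 d e = P2 d e ∘ₗ (u.rTensor H) := by
    apply D2_P2 d e hL
    rw [LinearMap.rTensor, ← TensorProduct.map_comp, ← TensorProduct.map_comp]; rfl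
  have invV := congrArg (fun X => LinearMap.det (D2 d e X)) s.invV
  have invH := congrArg (fun X => LinearMap.det (D2 e e X)) s.invH
  have i3V := congrArg (fun X => LinearMap.det (D2 d e X)) s.i3V
  have i3H := congrArg (fun X => LinearMap.det (D2 e e X)) s.i3H
  have i4V := congrArg (fun X => LinearMap.det (D2 d e X)) s.i4V
  have i4H := congrArg (fun X => LinearMap.det (D2 e e X)) s.i4H
  have i5 := congrArg (fun X => LinearMap.det (D2 d e X)) s.i5
  simp only [D2_comp d e _ _ cFV, D2_comp e e _ _ cFH, D2_id, LinearMap.det_comp, LinearMap.det_id] at invV invH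
  have fV : LinearMap.det (D2 d e s.FV) ≠ 0 := left_ne_zero_of_mul_eq_one invV
  have fH : LinearMap.det (D2 e e s.FH) ≠ 0 := left_ne_zero_of_mul_eq_one invH
  simp only [D2_comp d e _ _ cAVH, D2_comp d e _ _ cFV, LinearMap.det_comp] at i3V
  simp only [D2_comp e e _ _ cAHH, D2_comp e e _ _ cFH, LinearMap.det_comp] at i3H
  simp only [D2_comp d e _ _ cQV, D2_comp d e _ _ cFV, LinearMap.det_comp, det_D2_comm] at i4V
  simp only [D2_comp e e _ _ cQH, D2_comp e e _ _ cFH, LinearMap.det_comp, det_D2_comm] at i4H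
  simp only [D2_comp d e _ _ cAVH, D2_comp d e _ _ cQV, D2_comp d e _ _ cu, LinearMap.det_comp, det_D2_comm,
    D2_rTensor, det_rTensor_pow, Module.finrank_fintype_fun_eq_card] at i5
  have j3V : LinearMap.det (D2 d e s.AVH) * LinearMap.det (D2 d e s.BV) = 1 :=
    mul_left_cancel₀ fV (by linear_combination i3V)
  have j3H : LinearMap.det (D2 e e s.AHH) * LinearMap.det (D2 e e s.BH) = 1 :=
    mul_left_cancel₀ fH (by linear_combination i3H)
  have j4V : LinearMap.det (D2 d e s.QV) * LinearMap.det (D2 e d s.AHV) = 1 :=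
    mul_left_cancel₀ fV (by linear_combination i4V)
  have j4H : LinearMap.det (D2 e e s.QH) * LinearMap.det (D2 e e s.AHH) = 1 :=
    mul_left_cancel₀ fH (by linear_combination i4H)
  have b1 := det_i1 d e e cAVH cAVH cQH s.i1V (left_ne_zero_of_mul_eq_one j3V) (left_ne_zero_of_mul_eq_one j4H)
  have a1 := det_i1 e d e cAHV cAHH cQV s.i1H (left_ne_zero_of_mul_eq_one j3H) (left_ne_zero_of_mul_eq_one j4V)
  generalize LinearMap.det (D2 d e s.AVH) = b at *
  generalize LinearMap.det (D2 e d s.AHV) = a at *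
  generalize LinearMap.det (D2 d e s.QV) = a' at *
  generalize LinearMap.det (D2 d e s.BV) = b' at *
  have : LinearMap.det (d.D1 u) ^ Fintype.card e.J = (a * b) ^ 2 := by
    generalize LinearMap.det (d.D1 u) ^ Fintype.card e.J = w at *
    linear_combination (-a * b) * i5 - w * b * b' * j4V  - w * j3V
  rw [pow_mul, this, ← pow_mul, mul_comm 2, pow_mul, mul_pow, a1, b1]
  simp

theorem sys_finite {K V H : Type*} [Field K] [IsAlgClosed K] [AddCommGroup V] [Module K V] [AddCommGroup H] [Module K H]
    [FiniteDimensional K V] [Nontrivial V] [FiniteDimensional K H] [Nontrivial H]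
    (p : ℕ) [Fact p.Prime] [CharP K p]
    {u : V →ₗ[K] V} {σ : H →ₗ[K] H} (s : Sys u σ) (hu : Function.Injective u) (hσ : Function.Injective σ) :
    ∃ N : ℕ, 0 < N ∧ u ^ N = 1 := by
  classical
  obtain ⟨m1, h1⟩ := exists_eigenbasis p u hu
  obtain ⟨m2, h2⟩ := exists_eigenbasis p σ hσ
  obtain ⟨n, b, t, ht, hb⟩ := h1 (max m1 m2) (le_max_left _ _)
  obtain ⟨n', b', t', ht', hb'⟩ := h2 (max m1 m2) (le_max_right _ _)
  set q := p ^ max m1 m2 with hq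
  have hq0 : 0 < q := pow_pos (Fact.out : p.Prime).pos _
  have hroot : ∀ i, ∃ N : ℕ, 0 < N ∧ t i ^ N = 1 := by
    intro i0
    by_contra hcon
    push Not at hcon
    obtain ⟨L, hL, hpos⟩ := exists_log (t i0) (ht i0) hcon
    have : Nonempty (Fin n) := ⟨i0⟩
    have : Nonempty (Fin n') := b'.index_nonempty
    obtain ⟨j, hj⟩ := Finite.exists_max (fun i => L (t i))
    obtain ⟨j', hj'⟩ := Finite.exists_max (fun i => L (t' i))
    let d : TopD u q L := ⟨n, b, t, ht, hb, L (t j), hj, j, rfl⟩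
    let e : TopD σ q L := ⟨n', b', t', ht', hb', L (t' j'), hj', j', rfl⟩
    have hdet := sys_det s hL d e
    have hdiag : LinearMap.det (d.D1 u) ^ q = ∏ i : d.J, t i.1 := by
      rw [← map_pow]
      have hpw : ∀ N : ℕ, ((d.D1 u) ^ N) ∘ₗ d.pr = d.pr ∘ₗ (u ^ N) := by
        intro N
        induction N with
        | zero => rfl
        | succ N ih =>
          rw [pow_succ', pow_succ', Module.End.mul_eq_comp, Module.End.mul_eq_comp, LinearMap.comp_assoc, ih,
            ← LinearMap.comp_assoc, TopD.D1_pr d u rfl, LinearMap.comp_assoc]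
      have hmat : LinearMap.toMatrix (Pi.basisFun K d.J) (Pi.basisFun K d.J) (d.D1 u ^ q) =
          Matrix.diagonal (fun i : d.J => t i.1) := by
        ext i k
        rw [LinearMap.toMatrix_apply, Pi.basisFun_apply, ← d.pr_top k]
        have h5 := LinearMap.congr_fun (hpw q) (d.b k.1)
        simp only [LinearMap.comp_apply] at h5
        rw [h5, d.eig, map_smul, d.pr_top]
        by_cases hik : i = k
        · subst hik; simp [d]
        · simp [Matrix.diagonal_apply_ne _ hik, hik, Pi.single_apply]
      rw [← LinearMap.det_toMatrix (Pi.basisFun K d.J), hmat, Matrix.det_diagonal]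
    have hL1 : L 1 = 0 := by
      have := hL 1 1 one_ne_zero one_ne_zero
      rw [mul_one] at this; linarith
    have hLp : ∀ (x : K) (N : ℕ), x ≠ 0 → L (x ^ N) = N * L x := by
      intro x N hx
      induction N with
      | zero => simp [hL1]
      | succ N ih => rw [pow_succ, hL _ _ (pow_ne_zero _ hx) hx, ih]; push_cast; ring
    have hLprod : ∀ S : Finset d.J, L (∏ i ∈ S, t i.1) = S.card * L (t j) := by
      intro S
      induction S using Finset.induction_on with
      | empty => simp [hL1]
      | insert a S ha ih =>
        rw [Finset.prod_insert ha, hL _ _ (ht _) (Finset.prod_ne_zero_iff.2 fun i _ => ht _), ih,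
          Finset.card_insert_of_notMem ha, show L (t a.1) = L (t j) from a.2]
        push_cast; ring
    set N := Fintype.card e.J * Fintype.card e.J with hN
    have hN0 : 0 < N := by
      have : 0 < Fintype.card e.J := Fintype.card_pos_iff.2 ⟨⟨j', rfl⟩⟩
      exact Nat.mul_pos this this
    have hJ : 0 < Fintype.card d.J := Fintype.card_pos_iff.2 ⟨⟨j, rfl⟩⟩
    have h6 : (∏ i : d.J, t i.1) ^ N = 1 := by
      rw [← hdiag, ← pow_mul, mul_comm, pow_mul, hdet, one_pow]
    have h7 := congrArg L h6
    rw [hLp _ _ (Finset.prod_ne_zero_iff.2 fun i _ => ht _), hLprod, hL1, Finset.card_univ] at h7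
    have h8 : 0 < L (t j) := hpos.trans_le (hj i0)
    have : (0:ℚ) < N * (Fintype.card d.J * L (t j)) := by positivity
    exact this.ne' h7
  choose Nf hN0 hN1 using hroot
  refine ⟨q * ∏ i, Nf i, Nat.mul_pos hq0 (Finset.prod_pos fun i _ => hN0 i), ?_⟩
  apply b.ext
  intro i
  have hpw : ∀ N, ((u ^ q) ^ N) (b i) = t i ^ N • b i := by
    intro N
    induction N with
    | zero => simp
    | succ N ih => rw [pow_succ', Module.End.mul_apply, ih, map_smul, hb, smul_smul, pow_succ]
  obtain ⟨c, hc⟩ := Finset.dvd_prod_of_mem Nf (Finset.mem_univ i)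
  rw [pow_mul, hpw, hc, pow_mul, hN1, one_pow, one_smul]; rfl
end L3


section H1
open Coalgebra HopfAlgebra

variable {K H : Type*} [Field K] [Ring H] [HopfAlgebra K H]

noncomputable def opA {C M : Type*} [AddCommGroup C] [Module K C] [AddCommGroup M] [Module K M]
    (δ : C →ₗ[K] C ⊗[K] H) (a : M →ₗ[K] H →ₗ[K] M) : C ⊗[K] M →ₗ[K] C ⊗[K] M :=
  (TensorProduct.lift a.flip).lTensor C ∘ₗ (TensorProduct.assoc K C H M).toLinearMap ∘ₗ δ.rTensor M

noncomputable def opQ {M : Type*} [AddCommGroup M] [Module K M]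
    (a : M →ₗ[K] H →ₗ[K] M) : M ⊗[K] H →ₗ[K] M ⊗[K] H :=
  (TensorProduct.lift a).rTensor H ∘ₗ (TensorProduct.assoc K M H H).symm.toLinearMap ∘ₗ
    (comul (R := K) (A := H)).lTensor M

section ops
variable {C M : Type*} [AddCommGroup C] [Module K C] [AddCommGroup M] [Module K M]
    {δ : C →ₗ[K] C ⊗[K] H} {a : M →ₗ[K] H →ₗ[K] M}

theorem opA_tmul {ι : Type*} [Fintype ι] (c : C) (b : ι → C) (h : ι → H) (hc : δ c = ∑ i, b i ⊗ₜ h i)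
    (m : M) : opA δ a (c ⊗ₜ m) = ∑ i, b i ⊗ₜ a m (h i) := by
  simp [opA, hc, sum_tmul]

theorem opQ_tmul {ι : Type*} [Fintype ι] (m : M) (x : H) (y z : ι → H)
    (hc : comul (R := K) x = ∑ i, y i ⊗ₜ[K] z i) :
    opQ a (m ⊗ₜ x) = ∑ i, a m (y i) ⊗ₜ z i := by
  simp [opQ, hc, tmul_sum]

theorem opA_comm (f : C →ₗ[K] C) (g : M →ₗ[K] M) (s : H →ₗ[K] H)
    (h1 : ∀ c, δ (f c) = TensorProduct.map f s (δ c)) (h2 : ∀ m x, g (a m x) = a (g m) (s x)) :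
    opA δ a ∘ₗ TensorProduct.map f g = TensorProduct.map f g ∘ₗ opA δ a := by
  apply TensorProduct.ext'
  intro c m
  simp only [opA, LinearMap.comp_apply, TensorProduct.map_tmul, LinearMap.rTensor_tmul, h1]
  generalize δ c = t
  induction t using TensorProduct.induction_on with
  | zero => simp
  | tmul x y => simp [h2]
  | add x y hx hy => simp only [map_add, add_tmul, hx, hy]

theorem opQ_comm (g : M →ₗ[K] M) (s : H →ₗ[K] H)
    (h1 : ∀ x, comul (R := K) (s x) = TensorProduct.map s s (comul (R := K) x))
    (h2 : ∀ m x, g (a m x) = a (g m) (s x)) :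
    opQ a ∘ₗ TensorProduct.map g s = TensorProduct.map g s ∘ₗ opQ a := by
  apply TensorProduct.ext'
  intro m x
  simp only [opQ, LinearMap.comp_apply, TensorProduct.map_tmul, LinearMap.lTensor_tmul, h1]
  generalize comul (R := K) x = t
  induction t using TensorProduct.induction_on with
  | zero => simp
  | tmul x y => simp [h2]
  | add x y hx hy => simp only [map_add, tmul_add, hx, hy]
end ops

/-- spanning by coefficients -/
theorem exists_span_coef (K H : Type*) [Field K] [Ring H] [HopfAlgebra K H] [FiniteDimensional K H] :
    ∃ g : Fin (Module.finrank K H) → Fin (Module.finrank K H) → H, IsCoef (K := K) g ∧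
      ∀ x : H, x ∈ Submodule.span K (Set.range fun ij : Fin (Module.finrank K H) × Fin (Module.finrank K H) => g ij.1 ij.2) := by
  obtain ⟨g, hg, hc⟩ := exists_coef (isCoact_comul (K := K) (H := H)) (Module.finBasis K H)
  refine ⟨g, hc, fun x => ?_⟩
  have hb : ∀ j, Module.finBasis K H j = ∑ i, counit (R := K) (Module.finBasis K H i) • g i j := by
    intro j
    have := congrArg (TensorProduct.lid K H) (rTensor_counit_comul (R := K) (Module.finBasis K H j))
    rw [hg] at this
    simpa using this.symm
  rw [← (Module.finBasis K H).sum_repr x]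
  refine Submodule.sum_mem _ fun j _ => Submodule.smul_mem _ _ ?_
  rw [hb j]
  exact Submodule.sum_mem _ fun i _ => Submodule.smul_mem _ _ (Submodule.subset_span ⟨(i, j), rfl⟩)

theorem ext_coef {X ι : Type*} [AddCommGroup X] [Module K X] {g : ι → ι → H}
    (hs : ∀ x : H, x ∈ Submodule.span K (Set.range fun ij : ι × ι => g ij.1 ij.2))
    {f f' : H →ₗ[K] X} (h : ∀ i j, f (g i j) = f' (g i j)) : f = f' := by
  apply LinearMap.ext_on_range (v := fun ij : ι × ι => g ij.1 ij.2)
  · rw [eq_top_iff]; exact fun x _ => hs x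
  · exact fun ij => h _ _

section ids
variable {C M ι κ : Type*} [AddCommGroup C] [Module K C] [AddCommGroup M] [Module K M]
    [Fintype ι] [DecidableEq ι] [Fintype κ] [DecidableEq κ]
    {δ : C →ₗ[K] C ⊗[K] H} {a : M →ₗ[K] H →ₗ[K] M}
    {b : Module.Basis ι K C} {h : ι → ι → H} (hδ : ∀ j, δ (b j) = ∑ i, b i ⊗ₜ h i j)
    (hh : IsCoef (K := K) h) {g : κ → κ → H} (hg : IsCoef (K := K) g)
    (hs : ∀ x : H, x ∈ Submodule.span K (Set.range fun ij : κ × κ => g ij.1 ij.2))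
    (Sinv : H →ₗ[K] H)
    (hS1 : Sinv ∘ₗ antipode (R := K) (A := H) = LinearMap.id)
    (hS2 : antipode (R := K) (A := H) ∘ₗ Sinv = LinearMap.id)

include hδ hh hS1 hS2 in
theorem id_I3 : opA δ (LinearMap.mul K H) ∘ₗ Sinv.lTensor C ∘ₗ opA δ (LinearMap.mul K H).flip =
    Sinv.lTensor C := by
  apply TensorProduct.ext
  apply b.ext
  intro j
  ext x
  simp only [LinearMap.compr₂_apply, LinearMap.compr₂ₛₗ_apply, TensorProduct.mk_apply, LinearMap.comp_apply, opA_tmul _ _ _ (hδ _),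
    map_sum, LinearMap.lTensor_tmul, LinearMap.flip_apply, LinearMap.mul_apply', Sinv_mul Sinv hS1 hS2]
  rw [Finset.sum_comm]
  simp only [← tmul_sum, mul_assoc, ← Finset.mul_sum, hh.Sinv_mul Sinv hS1 hS2]
  simp [tmul_ite]

include hg hs hS1 hS2 in
theorem id_I4 [FiniteDimensional K H] (ha : IsAct (K := K) a) :
    opQ a ∘ₗ Sinv.lTensor M ∘ₗ ((TensorProduct.comm K H M).toLinearMap ∘ₗ
      opA (comul (R := K) (A := H)) a ∘ₗ (TensorProduct.comm K H M).symm.toLinearMap) = Sinv.lTensor M := by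
  have hSg : ∀ i j, comul (R := K) (Sinv (g i j)) = ∑ k, Sinv (g k j) ⊗ₜ[K] Sinv (g i k) := by
    intro i j
    rw [comul_Sinv Sinv hS1 hS2, hg.cm]; simp
  apply TensorProduct.ext
  ext m : 1
  apply ext_coef hs
  intro i j
  simp only [LinearMap.compr₂_apply, LinearMap.compr₂ₛₗ_apply, TensorProduct.mk_apply, LinearMap.comp_apply, LinearEquiv.coe_coe,
    TensorProduct.comm_symm_tmul, opA_tmul _ _ _ (hg.cm i j), map_sum, TensorProduct.comm_tmul,
    LinearMap.lTensor_tmul, opQ_tmul _ _ _ _ (hSg _ _)]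
  rw [Finset.sum_comm]
  simp only [← sum_tmul, ← ha.mul, ← map_sum, hg.mul_Sinv Sinv hS1 hS2]
  rw [Finset.sum_eq_single j]
  · simp [ha.one]
  · intro k _ hk; simp [hk]
  · simp

include hδ hh hg hs in
theorem id_I1 (ha : IsAct (K := K) a) :
    F12 H (opA δ a) ∘ₗ F13 M (opA δ (LinearMap.mul K H)) ∘ₗ F23 C (opQ a) =
      F23 C (opQ a) ∘ₗ F13 M (opA δ (LinearMap.mul K H)) := by
  apply TensorProduct.ext
  apply TensorProduct.ext
  apply b.ext
  intro j
  ext m : 1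
  apply ext_coef hs
  intro x y
  have hgh : ∀ i, comul (R := K) (g x y * h i j) =
      ∑ kl : κ × ι, (g x kl.1 * h i kl.2) ⊗ₜ[K] (g kl.1 y * h kl.2 j) := by
    intro i
    rw [Bialgebra.comul_mul, hg.cm, hh.cm, Finset.sum_mul_sum, Fintype.sum_prod_type]
    simp only [Algebra.TensorProduct.tmul_mul_tmul]
  simp only [LinearMap.compr₂_apply, LinearMap.compr₂ₛₗ_apply, TensorProduct.mk_apply, LinearMap.comp_apply, LinearEquiv.coe_coe,
    F12, F13, F23, TensorProduct.assoc_tmul, LinearMap.lTensor_tmul, LinearMap.rTensor_tmul,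
    TensorProduct.rightComm_tmul, opA_tmul _ _ _ (hδ _), opQ_tmul _ _ _ _ (hg.cm _ _),
    opQ_tmul _ _ _ _ (hgh _), tmul_sum, sum_tmul, map_sum, TensorProduct.assoc_symm_tmul,
    LinearMap.mul_apply', ← ha.mul, Fintype.sum_prod_type]
  rw [Finset.sum_comm]
  conv_lhs => enter [2, i]; rw [Finset.sum_comm]
  rw [Finset.sum_comm]
  refine Finset.sum_congr rfl fun i _ => ?_
  rw [Finset.sum_comm]
end ids
end H1


section H2
open Coalgebra HopfAlgebra

variable {K H : Type*} [Field K] [Ring H] [HopfAlgebra K H]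

/-- Yetter-Drinfeld condition, tested on coefficient families. -/
def IsYD {V : Type*} [AddCommGroup V] [Module K V] (δ : V →ₗ[K] V ⊗[K] H)
    (a : V →ₗ[K] H →ₗ[K] V) : Prop :=
  ∀ v x, TensorProduct.lift (LinearMap.mk₂ K (fun y z => (LinearMap.mulLeft K y).lTensor V (δ (a v z)))
    (fun y y' z => by rw [← LinearMap.add_apply, ← LinearMap.lTensor_add]; congr 2; ext; simp [add_mul])
    (fun c y z => by rw [← LinearMap.smul_apply, ← LinearMap.lTensor_smul]; congr 2; ext; simp)
    (fun y z z' => by simp) (fun c y z => by simp)) (comul (R := K) (A := H) x) =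
    TensorProduct.map₂ a (LinearMap.mul K H) (δ v) (comul (R := K) x)

noncomputable def uMap {V : Type*} [AddCommGroup V] [Module K V] (δ : V →ₗ[K] V ⊗[K] H)
    (a : V →ₗ[K] H →ₗ[K] V) (s : H →ₗ[K] H) : V →ₗ[K] V :=
  TensorProduct.lift a ∘ₗ s.lTensor V ∘ₗ δ

theorem uMap_apply {V ι : Type*} [AddCommGroup V] [Module K V] [Fintype ι] {δ : V →ₗ[K] V ⊗[K] H}
    {a : V →ₗ[K] H →ₗ[K] V} {s : H →ₗ[K] H} {v : V} {w : ι → V} {h : ι → H}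
    (hv : δ v = ∑ i, w i ⊗ₜ h i) : uMap δ a s v = ∑ i, a (w i) (s (h i)) := by
  simp [uMap, hv]

section yd
variable {V ι κ : Type*} [AddCommGroup V] [Module K V]
    [Fintype ι] [DecidableEq ι] [Fintype κ] [DecidableEq κ]
    {δ : V →ₗ[K] V ⊗[K] H} {a : V →ₗ[K] H →ₗ[K] V} (hY : IsYD δ a) (ha : IsAct (K := K) a)
    {b : Module.Basis ι K V} {h : ι → ι → H} (hδ : ∀ j, δ (b j) = ∑ i, b i ⊗ₜ h i j)
    (hh : IsCoef (K := K) h)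

theorem IsYD.coef {δ : V →ₗ[K] V ⊗[K] H} {a : V →ₗ[K] H →ₗ[K] V} (hY : IsYD δ a)
    {b : Module.Basis ι K V} {h : ι → ι → H} (hδ : ∀ j, δ (b j) = ∑ i, b i ⊗ₜ h i j)
    {c : κ → κ → H} (hc : IsCoef (K := K) c) (j x y) :
    ∑ k, (LinearMap.mulLeft K (c x k)).lTensor V (δ (a (b j) (c k y))) =
      ∑ i, ∑ k, a (b i) (c x k) ⊗ₜ[K] (h i j * c k y) := by
  have := hY (b j) (c x y)
  rw [hc.cm, hδ] at this
  rw [Finset.sum_comm]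
  simpa using this

theorem IsCoef.transS (hh : IsCoef (K := K) h) : IsCoef (K := K) (fun i j => antipode K (h j i)) := by
  refine ⟨fun i j => hh.cm_S _ _, fun i j => ?_⟩
  rw [counit_antipode, hh.cu]; simp only [eq_comm]

include hY ha hδ in
theorem u_act {g : κ → κ → H} (hg : IsCoef (K := K) g)
    (hs : ∀ x : H, x ∈ Submodule.span K (Set.range fun ij : κ × κ => g ij.1 ij.2)) (v : V) (x : H) :
    uMap δ a (antipode K) (a v x) = a (uMap δ a (antipode K) v) (antipode K (antipode K x)) := by
  set u := uMap δ a (antipode K) with hu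
  have key : ∀ j x y, ∑ k, a (u (a (b j) (g k y))) (antipode K (g x k)) = if x = y then u (b j) else 0 := by
    intro j x y
    have h1 := congrArg (TensorProduct.lift a ∘ₗ (antipode K).lTensor V) (hY.coef hδ hg j x y)
    have h2 : ∀ (y : H) (t : V ⊗[K] H), (TensorProduct.lift a ∘ₗ (antipode K).lTensor V)
        ((LinearMap.mulLeft K y).lTensor V t) =
        a ((TensorProduct.lift a ∘ₗ (antipode K).lTensor V) t) (antipode K y) := by
      intro y t
      induction t using TensorProduct.induction_on with
      | zero => simp
      | tmul p q => simp [antipode_mul_antidistrib, ha.mul]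
      | add p q hp hq => rw [map_add, map_add, hp, hq, map_add, map_add, LinearMap.add_apply]
    simp only [map_sum, h2] at h1
    have h3 : ∀ v, (TensorProduct.lift a ∘ₗ (antipode K).lTensor V) (δ v) = u v := fun v => rfl
    simp only [h3] at h1
    rw [h1]
    simp only [LinearMap.comp_apply, LinearMap.lTensor_tmul, TensorProduct.lift.tmul, ← ha.mul,
      antipode_mul_antidistrib, ← mul_assoc]
    simp only [← map_sum, ← Finset.sum_mul, hg.mul_S]
    split_ifs
    · simp [hu, uMap_apply (hδ j)]
    · simp
  have hfin : ∀ j x y, u (a (b j) (g x y)) = a (u (b j)) (antipode K (antipode K (g x y))) := by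
    intro j l y
    have h4 : ∀ k, ∑ x, antipode K (g x k) * antipode K (antipode K (g l x)) = if l = k then 1 else 0 := by
      intro k
      simp only [← antipode_mul_antidistrib, ← map_sum, hg.S_mul]
      split_ifs <;> simp
    have h5 : ∑ x, a (∑ k, a (u (a (b j) (g k y))) (antipode K (g x k))) (antipode K (antipode K (g l x)))
        = u (a (b j) (g l y)) := by
      simp only [map_sum, LinearMap.sum_apply, ← ha.mul]
      rw [Finset.sum_comm]
      simp only [← map_sum, h4]
      rw [Finset.sum_eq_single l]
      · simp [ha.one]
      · intro k _ hk; simp [Ne.symm hk]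
      · simp
    rw [← h5]
    simp only [key]
    rw [Finset.sum_eq_single y]
    · simp
    · intro k _ hk; simp [hk]
    · simp
  have e1 : a.compr₂ u = a.compl₁₂ u (antipode K ∘ₗ antipode K) := by
    apply b.ext
    intro j
    apply ext_coef hs
    intro x y
    exact hfin j x y
  exact LinearMap.congr_fun (LinearMap.congr_fun e1 v) x

include hY ha hδ hh in
theorem u_coact (v : V) :
    δ (uMap δ a (antipode K) v) =
      TensorProduct.map (uMap δ a (antipode K)) (antipode K ∘ₗ antipode K) (δ v) := by
  set u := uMap δ a (antipode K) with hu
  have hub : ∀ k, u (b k) = ∑ m, a (b m) (antipode K (h m k)) := fun k => uMap_apply (hδ k)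
  have key : ∀ x, ∑ k, (LinearMap.mulLeft K (antipode K (h k x))).lTensor V (δ (u (b k))) = u (b x) ⊗ₜ 1 := by
    intro x
    have h1 : ∀ m, _ := fun m => hY.coef hδ (hh.transS) m x m
    have h2 := Finset.sum_congr (rfl : (Finset.univ : Finset ι) = Finset.univ) (fun m _ => h1 m)
    rw [Finset.sum_comm] at h2
    simp only [← map_sum, ← hub] at h2
    rw [h2, Finset.sum_comm]
    rw [hub, sum_tmul]
    refine Finset.sum_congr rfl fun i _ => ?_
    rw [Finset.sum_comm]
    simp only [← tmul_sum, hh.mul_S]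
    simp [tmul_ite]
  have e1 : δ ∘ₗ u = TensorProduct.map u (antipode K ∘ₗ antipode K) ∘ₗ δ := by
    apply b.ext
    intro j
    simp only [LinearMap.comp_apply, hδ j, map_sum, TensorProduct.map_tmul]
    have h5 : ∑ x, (LinearMap.mulLeft K (antipode K (antipode K (h x j)))).lTensor V
        (∑ k, (LinearMap.mulLeft K (antipode K (h k x))).lTensor V (δ (u (b k)))) = δ (u (b j)) := by
      have h6 : ∀ k (t : V ⊗[K] H), ∑ x, (LinearMap.mulLeft K (antipode K (antipode K (h x j)))).lTensor V
        ((LinearMap.mulLeft K (antipode K (h k x))).lTensor V t) = if k = j then t else 0 := by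
        intro k t
        induction t using TensorProduct.induction_on with
        | zero => simp
        | tmul p q =>
          simp only [LinearMap.lTensor_tmul, LinearMap.mulLeft_apply, ← mul_assoc,
            ← antipode_mul_antidistrib, ← tmul_sum, ← Finset.sum_mul, ← map_sum, hh.mul_S]
          split_ifs <;> simp
        | add p q hp hq =>
          simp only [map_add, Finset.sum_add_distrib, hp, hq]
          split_ifs <;> simp
      simp only [map_sum]
      rw [Finset.sum_comm]
      simp only [h6]
      simp
    rw [← h5]
    simp only [key, LinearMap.lTensor_tmul, LinearMap.mulLeft_apply, mul_one]
  exact LinearMap.congr_fun e1 v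

include ha hδ hh in
theorem u_inv (m) : ∑ i, a (uMap δ a (antipode K) (b i)) (h i m) = b m := by
  simp only [uMap_apply (hδ _), map_sum, LinearMap.sum_apply, ← ha.mul]
  rw [Finset.sum_comm]
  simp only [← map_sum, hh.S_mul]
  rw [Finset.sum_eq_single m]
  · simp [ha.one]
  · intro k _ hk; simp [hk]
  · simp

include hY ha hδ hh in
theorem id_I5 {g : κ → κ → H} (hg : IsCoef (K := K) g)
    (hs : ∀ x : H, x ∈ Submodule.span K (Set.range fun ij : κ × κ => g ij.1 ij.2)) :
    opA δ (LinearMap.mul K H) ∘ₗ ((TensorProduct.comm K H V).toLinearMap ∘ₗ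
      opA (comul (R := K) (A := H)) a ∘ₗ (TensorProduct.comm K H V).symm.toLinearMap) =
    opQ a ∘ₗ (uMap δ a (antipode K)).rTensor H ∘ₗ opA δ (LinearMap.mul K H).flip := by
  apply TensorProduct.ext
  apply b.ext
  intro j
  apply ext_coef hs
  intro x y
  have hA : ∀ (v : V) (z : H), opA δ (LinearMap.mul K H) (v ⊗ₜ z) = (LinearMap.mulLeft K z).lTensor V (δ v) := by
    intro v z
    simp only [opA, LinearMap.comp_apply, LinearMap.rTensor_tmul]
    generalize δ v = t
    induction t using TensorProduct.induction_on with
    | zero => simp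
    | tmul p q => simp
    | add p q hp hq => simp only [map_add, add_tmul, hp, hq]
  have hgh : ∀ i, comul (R := K) (h i j * g x y) =
      ∑ kl : ι × κ, (h i kl.1 * g x kl.2) ⊗ₜ[K] (h kl.1 j * g kl.2 y) := by
    intro i
    rw [Bialgebra.comul_mul, hg.cm, hh.cm, Finset.sum_mul_sum, Fintype.sum_prod_type]
    simp only [Algebra.TensorProduct.tmul_mul_tmul]
  simp only [LinearMap.compr₂_apply, LinearMap.compr₂ₛₗ_apply, TensorProduct.mk_apply, LinearMap.comp_apply,
    LinearEquiv.coe_coe, TensorProduct.comm_symm_tmul, opA_tmul _ _ _ (hg.cm _ _), opA_tmul _ _ _ (hδ _), map_sum,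
    TensorProduct.comm_tmul, hA, hY.coef hδ hg, LinearMap.flip_apply, LinearMap.mul_apply',
    LinearMap.rTensor_tmul, opQ_tmul _ _ _ _ (hgh _), ha.mul]
  simp only [Fintype.sum_prod_type]
  conv_rhs => rw [Finset.sum_comm]
  refine Finset.sum_congr rfl fun m _ => ?_
  conv_rhs => rw [Finset.sum_comm]
  refine Finset.sum_congr rfl fun k _ => ?_
  simp only [← sum_tmul, ← LinearMap.sum_apply, ← map_sum, u_inv ha hδ hh]

end yd
end H2


section H3
open Coalgebra HopfAlgebra

variable {K H : Type*} [Field K] [Ring H] [HopfAlgebra K H]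

theorem sigma_comul [FiniteDimensional K H] (x : H) :
    comul (R := K) ((antipode K ∘ₗ antipode K) x) =
      TensorProduct.map (antipode K ∘ₗ antipode K) (antipode K ∘ₗ antipode K) (comul (R := K) x) := by
  rw [LinearMap.comp_apply, comul_antipode, comul_antipode]
  generalize comul (R := K) x = t
  induction t using TensorProduct.induction_on with
  | zero => simp
  | tmul p q => simp
  | add p q hp hq => simp only [map_add, hp, hq]

theorem sigma_mul (x y : H) : (antipode K ∘ₗ antipode K) (x * y) =
    (antipode K ∘ₗ antipode K) x * (antipode K ∘ₗ antipode K (A := H)) y := by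
  simp [antipode_mul_antidistrib]

theorem isAct_mul : IsAct (K := K) (LinearMap.mul K H) :=
  ⟨fun m => by simp, fun m x y => by simp [mul_assoc]⟩

noncomputable def ydSys [FiniteDimensional K H] {V ι κ : Type*} [AddCommGroup V] [Module K V]
    [Fintype ι] [DecidableEq ι] [Fintype κ] [DecidableEq κ]
    {δ : V →ₗ[K] V ⊗[K] H} {a : V →ₗ[K] H →ₗ[K] V} (hY : IsYD δ a) (ha : IsAct (K := K) a)
    {b : Module.Basis ι K V} {h : ι → ι → H} (hδ : ∀ j, δ (b j) = ∑ i, b i ⊗ₜ h i j)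
    (hh : IsCoef (K := K) h) 
    {e : Module.Basis κ K H} {g : κ → κ → H} (he : ∀ j, comul (R := K) (e j) = ∑ i, e i ⊗ₜ g i j)
    (hg : IsCoef (K := K) g)
    (hs : ∀ x : H, x ∈ Submodule.span K (Set.range fun ij : κ × κ => g ij.1 ij.2))
    (Sinv : H →ₗ[K] H)
    (hS1 : Sinv ∘ₗ antipode (R := K) (A := H) = LinearMap.id)
    (hS2 : antipode (R := K) (A := H) ∘ₗ Sinv = LinearMap.id) :
    Sys (K := K) (V := V) (H := H) (uMap δ a (antipode K)) (antipode K ∘ₗ antipode K) where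
  AVH := opA δ (LinearMap.mul K H)
  BV := opA δ (LinearMap.mul K H).flip
  QV := opQ a
  FV := Sinv.lTensor V
  GV := (antipode K).lTensor V
  AHV := opA (comul (R := K) (A := H)) a
  AHH := opA (comul (R := K) (A := H)) (LinearMap.mul K H)
  BH := opA (comul (R := K) (A := H)) (LinearMap.mul K H).flip
  QH := opQ (LinearMap.mul K H)
  FH := Sinv.lTensor H
  GH := (antipode K).lTensor H
  cAVH := opA_comm _ _ _ (u_coact hY ha hδ hh) (fun m x => sigma_mul m x)
  cBV := opA_comm _ _ _ (u_coact hY ha hδ hh) (fun m x => sigma_mul x m)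
  cQV := opQ_comm _ _ sigma_comul (u_act hY ha hδ hg hs)
  cFV := by
    rw [LinearMap.lTensor, ← TensorProduct.map_comp, ← TensorProduct.map_comp, LinearMap.id_comp,
      LinearMap.comp_id, ← LinearMap.comp_assoc, hS1, LinearMap.comp_assoc, hS2]; rfl
  cGV := by
    rw [LinearMap.lTensor, ← TensorProduct.map_comp, ← TensorProduct.map_comp, LinearMap.id_comp,
      LinearMap.comp_id]; rfl
  cAHV := opA_comm _ _ _ sigma_comul (u_act hY ha hδ hg hs)
  cAHH := opA_comm _ _ _ sigma_comul (fun m x => sigma_mul m x)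
  cBH := opA_comm _ _ _ sigma_comul (fun m x => sigma_mul x m)
  cQH := opQ_comm _ _ sigma_comul (fun m x => sigma_mul m x)
  cFH := by
    rw [LinearMap.lTensor, ← TensorProduct.map_comp, ← TensorProduct.map_comp, LinearMap.id_comp,
      LinearMap.comp_id, ← LinearMap.comp_assoc, hS1, LinearMap.comp_assoc, hS2]; rfl
  cGH := by
    rw [LinearMap.lTensor, ← TensorProduct.map_comp, ← TensorProduct.map_comp, LinearMap.id_comp,
      LinearMap.comp_id]; rfl
  invV := by rw [← LinearMap.lTensor_comp, hS1, LinearMap.lTensor_id]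
  invH := by rw [← LinearMap.lTensor_comp, hS1, LinearMap.lTensor_id]
  i3V := id_I3 hδ hh Sinv hS1 hS2
  i3H := id_I3 he hg Sinv hS1 hS2
  i4V := id_I4 hg hs Sinv hS1 hS2 ha
  i4H := id_I4 hg hs Sinv hS1 hS2 isAct_mul
  i5 := id_I5 hY ha hδ hh hg hs
  i1V := id_I1 hδ hh hg hs isAct_mul
  i1H := id_I1 he hg hg hs ha

theorem exists_span_coef' (K H : Type*) [Field K] [Ring H] [HopfAlgebra K H] [FiniteDimensional K H] :
    ∃ g : Fin (Module.finrank K H) → Fin (Module.finrank K H) → H, IsCoef (K := K) g ∧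
      (∀ j, comul (R := K) (Module.finBasis K H j) = ∑ i, Module.finBasis K H i ⊗ₜ[K] g i j) ∧ 
      ∀ x : H, x ∈ Submodule.span K (Set.range fun ij : Fin (Module.finrank K H) × Fin (Module.finrank K H) => g ij.1 ij.2) := by
  obtain ⟨g, hg, hc⟩ := exists_coef (isCoact_comul (K := K) (H := H)) (Module.finBasis K H)
  refine ⟨g, hc, hg, fun x => ?_⟩
  have hb : ∀ j, Module.finBasis K H j = ∑ i, counit (R := K) (Module.finBasis K H i) • g i j := by
    intro j
    have := congrArg (TensorProduct.lid K H) (rTensor_counit_comul (R := K) (Module.finBasis K H j))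
    rw [hg] at this
    simpa using this.symm
  rw [← (Module.finBasis K H).sum_repr x]
  refine Submodule.sum_mem _ fun j _ => Submodule.smul_mem _ _ ?_
  rw [hb j]
  exact Submodule.sum_mem _ fun i _ => Submodule.smul_mem _ _ (Submodule.subset_span ⟨(i, j), rfl⟩)

theorem yd_finite [IsAlgClosed K] [FiniteDimensional K H] {V : Type*} [AddCommGroup V] [Module K V]
    [FiniteDimensional K V] [Nontrivial V] (p : ℕ) [Fact p.Prime] [CharP K p]
    {δ : V →ₗ[K] V ⊗[K] H} {a : V →ₗ[K] H →ₗ[K] V} (hY : IsYD δ a) (ha : IsAct (K := K) a)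
    (hc : IsCoact δ) (Sinv : H →ₗ[K] H)
    (hS1 : Sinv ∘ₗ antipode (R := K) (A := H) = LinearMap.id)
    (hS2 : antipode (R := K) (A := H) ∘ₗ Sinv = LinearMap.id) :
    ∃ N : ℕ, 0 < N ∧ ∀ v, TensorProduct.lift a
      (((Sinv ∘ₗ Sinv) ∘ₗ expMap K H Sinv N).lTensor V (δ v)) = v := by
  classical
  obtain ⟨g, hg, he, hs⟩ := exists_span_coef' K H
  obtain ⟨h, hδ, hh⟩ := exists_coef hc (Module.finBasis K V)
  set b := Module.finBasis K V
  have hnt : Nontrivial H := by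
    refine nontrivial_of_ne (1:H) 0 fun h0 => ?_
    have := Bialgebra.counit_one (R := K) (A := H)
    rw [h0, map_zero] at this
    exact zero_ne_one this
  set u := uMap δ a (antipode K) with hu
  set T := uMap δ a (Sinv ∘ₗ Sinv) with hT
  have hTu : T * u = 1 := by
    apply b.ext
    intro j
    have h1 : δ (u (b j)) = ∑ x, u (b x) ⊗ₜ antipode K (antipode K (h x j)) := by
      rw [hu, u_coact hY ha hδ hh, hδ]; simp
    rw [Module.End.mul_apply, hT, uMap_apply h1]
    simp only [LinearMap.comp_apply, Sinv_S Sinv hS1 hS2, Module.End.one_apply]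
    exact u_inv ha hδ hh j
  have huT : u * T = 1 := mul_eq_one_comm.1 hTu
  have huinj : Function.Injective u := by
    intro x y hxy
    have := congrArg T hxy
    rwa [← Module.End.mul_apply, ← Module.End.mul_apply, hTu] at this
  have hSi := S_inj Sinv hS1 hS2
  have hσinj : Function.Injective (antipode K ∘ₗ antipode K (A := H)) := by
    rw [LinearMap.coe_comp]; exact hSi.comp hSi
  obtain ⟨N, hN, hNu⟩ := sys_finite p (ydSys hY ha hδ hh he hg hs Sinv hS1 hS2) huinj hσinj
  refine ⟨N, hN, ?_⟩
  have hTN : T ^ N = 1 := by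
    have hcm : Commute T u := by rw [Commute, SemiconjBy, hTu, huT]
    have := hcm.mul_pow N
    rw [hTu, one_pow, hNu, mul_one] at this
    exact this.symm
  set τ := Sinv ∘ₗ Sinv with hτ
  have hτm : ∀ x y, τ (x * y) = τ x * τ y := by
    intro x y
    simp only [hτ, LinearMap.comp_apply, Sinv_mul Sinv hS1 hS2]
  have hTa : ∀ v x, T (a v x) = a (T v) (τ x) := by
    intro v x
    have h1 : u (a (T v) (τ x)) = a v x := by
      rw [hu, u_act hY ha hδ hg hs, ← hu, ← Module.End.mul_apply, huT]
      simp [hτ, S_Sinv Sinv hS1 hS2]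
    rw [← h1, ← Module.End.mul_apply, hTu]; rfl
  have hTna : ∀ (n : ℕ) v x, (T ^ n) (a v x) = a ((T ^ n) v) ((τ ^ n) x) := by
    intro n
    induction n with
    | zero => intro v x; rfl
    | succ n ih =>
      intro v x
      rw [pow_succ', pow_succ', Module.End.mul_apply, ih, hTa]; rfl
  have hTn : ∀ (n : ℕ) j, (T ^ (n + 1)) (b j) = ∑ i, a (b i) (τ (expMap K H Sinv (n + 1) (h i j))) := by
    intro n
    induction n with
    | zero =>
      intro j
      rw [zero_add, pow_one, hT, uMap_apply (hδ j)]
      rfl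
    | succ n ih =>
      intro j
      rw [pow_succ, Module.End.mul_apply, hT, uMap_apply (hδ j), ← hT, map_sum]
      simp only [hTna, ih, map_sum, LinearMap.sum_apply, ← ha.mul]
      rw [Finset.sum_comm]
      refine Finset.sum_congr rfl fun i _ => ?_
      rw [← map_sum]
      congr 1
      have hexp : expMap K H Sinv (n + 1 + 1) (h i j) =
          ∑ k, expMap K H Sinv (n + 1) (h i k) * (τ ^ (n + 1)) (h k j) := by
        have : expMap K H Sinv (n + 1 + 1) (h i j) = LinearMap.mul' K H
          (TensorProduct.map (expMap K H Sinv (n+1)) (τ ^ (n+1)) (comul (R := K) (h i j))) := rfl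
        rw [this, hh.cm]
        simp only [map_sum, TensorProduct.map_tmul, LinearMap.mul'_apply]
      rw [hexp]
      simp only [map_sum, hτm]
      refine Finset.sum_congr rfl fun k _ => ?_
      exact congrArg (_ * ·) (LinearMap.congr_fun (pow_mul_comm' τ (n + 1)) (h k j))
  have hfin : TensorProduct.lift a ∘ₗ ((τ ∘ₗ expMap K H Sinv N).lTensor V) ∘ₗ δ = 1 := by
    rw [← hTN]
    obtain ⟨n, rfl⟩ : ∃ n, N = n + 1 := ⟨N - 1, by omega⟩
    apply b.ext
    intro j
    rw [hTn]
    simp [hδ]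
  exact fun v => LinearMap.congr_fun hfin v
end H3


section H4
open Coalgebra HopfAlgebra

variable {K H : Type*} [Field K] [Ring H] [HopfAlgebra K H]

variable (K H) in
noncomputable def actV : (H ⊗[K] H) →ₗ[K] H →ₗ[K] (H ⊗[K] H) :=
  (LinearMap.mul K (H ⊗[K] H)).compl₂ (comul (R := K) (A := H))

variable (K H) in
noncomputable def coactV : (H ⊗[K] H) →ₗ[K] (H ⊗[K] H) ⊗[K] H :=
  (LinearMap.mul' K H ∘ₗ (antipode K).rTensor H).lTensor (H ⊗[K] H) ∘ₗ
    (TensorProduct.tensorTensorTensorComm K H H H H).toLinearMap ∘ₗ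
    TensorProduct.map ((TensorProduct.comm K H H).toLinearMap ∘ₗ comul (R := K)) (comul (R := K))

theorem actV_apply (v : H ⊗[K] H) (x : H) : actV K H v x = v * comul (R := K) x := rfl

theorem coactV_tmul {ι κ : Type*} [Fintype ι] [Fintype κ] {y n : H} {y1 y2 : ι → H} {n1 n2 : κ → H}
    (hy : comul (R := K) y = ∑ i, y1 i ⊗ₜ[K] y2 i) (hn : comul (R := K) n = ∑ i, n1 i ⊗ₜ[K] n2 i) :
    coactV K H (y ⊗ₜ n) = ∑ i, ∑ j, (y2 i ⊗ₜ n1 j) ⊗ₜ (antipode K (y1 i) * n2 j) := by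
  simp [coactV, hy, hn, sum_tmul, tmul_sum]
  try rw [Finset.sum_comm]

theorem isAct_actV : IsAct (K := K) (actV K H) :=
  ⟨fun m => by simp [actV_apply], fun m x y => by simp [actV_apply, mul_assoc]⟩

section
variable {κ : Type*} [Fintype κ] [DecidableEq κ] {g : κ → κ → H} (hg : IsCoef (K := K) g)
    (hs : ∀ x : H, x ∈ Submodule.span K (Set.range fun ij : κ × κ => g ij.1 ij.2))

theorem ext_coef2 {X : Type*} [AddCommGroup X] [Module K X] 
    (hs : ∀ x : H, x ∈ Submodule.span K (Set.range fun ij : κ × κ => g ij.1 ij.2))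
    {f f' : H ⊗[K] H →ₗ[K] X} (h : ∀ i j k l, f (g i j ⊗ₜ g k l) = f' (g i j ⊗ₜ g k l)) : f = f' := by
  apply TensorProduct.ext
  apply ext_coef hs
  intro i j
  apply ext_coef hs
  intro k l
  exact h i j k l

theorem coactV_coef (hg : IsCoef (K := K) g) (i j k l) : coactV K H (g i j ⊗ₜ g k l) =
    ∑ p, ∑ q, (g p j ⊗ₜ g k q) ⊗ₜ (antipode K (g i p) * g q l) :=
  coactV_tmul (hg.cm i j) (hg.cm k l)

theorem isCoact_coactV (hg : IsCoef (K := K) g) 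
    (hs : ∀ x : H, x ∈ Submodule.span K (Set.range fun ij : κ × κ => g ij.1 ij.2)) :
    IsCoact (coactV K H) := by
  constructor
  · have : (TensorProduct.assoc K (H ⊗[K] H) H H).toLinearMap ∘ₗ (coactV K H).rTensor H ∘ₗ coactV K H =
      (comul (R := K) (A := H)).lTensor (H ⊗[K] H) ∘ₗ coactV K H := by
      apply ext_coef2 hs
      intro i j k l
      simp only [LinearMap.comp_apply, coactV_coef hg, map_sum, LinearMap.rTensor_tmul, LinearMap.lTensor_tmul,
        sum_tmul, LinearEquiv.coe_coe, TensorProduct.assoc_tmul, Bialgebra.comul_mul, hg.cm_S, hg.cm,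
        Finset.sum_mul_sum, Algebra.TensorProduct.tmul_mul_tmul, tmul_sum]
      -- LHS: sum p q r s ; RHS: sum r s p q
      have e : ∀ F : κ → κ → κ → κ → (H ⊗[K] H) ⊗[K] (H ⊗[K] H),
          ∑ p, ∑ q, ∑ r, ∑ s, F p q r s = ∑ r, ∑ s, ∑ p, ∑ q, F p q r s := by
        intro F
        calc _ = ∑ pq : κ × κ, ∑ rs : κ × κ, F pq.1 pq.2 rs.1 rs.2 := by simp only [Fintype.sum_prod_type]
          _ = ∑ rs : κ × κ, ∑ pq : κ × κ, F pq.1 pq.2 rs.1 rs.2 := Finset.sum_comm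
          _ = _ := by simp only [Fintype.sum_prod_type]
      exact e _
    exact fun c => LinearMap.congr_fun this c
  · have : (counit (R := K) (A := H)).lTensor (H ⊗[K] H) ∘ₗ coactV K H =
      (TensorProduct.mk K (H ⊗[K] H) K).flip 1 := by
      apply ext_coef2 hs
      intro i j k l
      simp only [LinearMap.comp_apply, coactV_coef hg, map_sum, LinearMap.lTensor_tmul,
        Bialgebra.counit_mul, counit_antipode, hg.cu, LinearMap.flip_apply, TensorProduct.mk_apply]
      simp [tmul_ite, ite_mul]
    exact fun c => LinearMap.congr_fun this c

theorem isYD_V (hg : IsCoef (K := K) g) 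
    (hs : ∀ x : H, x ∈ Submodule.span K (Set.range fun ij : κ × κ => g ij.1 ij.2)) :
    IsYD (coactV K H) (actV K H) := by
  have hgg : ∀ i j k l, comul (R := K) (g i j * g k l) =
      ∑ pr : κ × κ, (g i pr.1 * g k pr.2) ⊗ₜ[K] (g pr.1 j * g pr.2 l) := by
    intro i j k l
    rw [Bialgebra.comul_mul, hg.cm, hg.cm, Finset.sum_mul_sum, Fintype.sum_prod_type]
    simp only [Algebra.TensorProduct.tmul_mul_tmul]
  have main : ∀ x y, ∑ z, (LinearMap.mulLeft K (g x z)).lTensor (H ⊗[K] H) ∘ₗ coactV K H ∘ₗ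
      (actV K H).flip (g z y) = ∑ z, (TensorProduct.map₂ (actV K H) (LinearMap.mul K H)).flip
        (g x z ⊗ₜ g z y) ∘ₗ coactV K H := by
    intro x y
    apply ext_coef2 hs
    intro i j k l
    simp only [LinearMap.sum_apply, LinearMap.comp_apply, LinearMap.flip_apply, actV_apply, hg.cm,
      Finset.mul_sum, Algebra.TensorProduct.tmul_mul_tmul, map_sum, coactV_tmul (hgg _ _ _ _) (hgg _ _ _ _),
      coactV_coef hg, TensorProduct.map₂_apply_tmul, LinearMap.mul_apply', sum_tmul, LinearMap.lTensor_tmul,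
      LinearMap.mulLeft_apply, antipode_mul_antidistrib, Fintype.sum_prod_type, ← mul_assoc]
    -- LHS: sum z w p r q s
    have e : ∀ F : κ → κ → κ → κ → κ → κ → (H ⊗[K] H) ⊗[K] H,
        ∑ z, ∑ w, ∑ p, ∑ r, ∑ q, ∑ s, F z w p r q s =
        ∑ w, ∑ p, ∑ r, ∑ q, ∑ s, ∑ z, F z w p r q s := by
      intro F
      calc _ = ∑ z, ∑ t : κ × κ × κ × κ × κ, F z t.1 t.2.1 t.2.2.1 t.2.2.2.1 t.2.2.2.2 := by
            simp only [Fintype.sum_prod_type]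
        _ = ∑ t : κ × κ × κ × κ × κ, ∑ z, F z t.1 t.2.1 t.2.2.1 t.2.2.2.1 t.2.2.2.2 := Finset.sum_comm
        _ = _ := by simp only [Fintype.sum_prod_type]
    rw [e]
    simp only [← tmul_sum, ← Finset.sum_mul, hg.mul_S, ite_mul, one_mul, zero_mul, tmul_ite, tmul_zero,
      Finset.sum_ite_eq, Finset.mem_univ, if_true]
    have hr : ∀ (w p r : κ), (∑ q, ∑ s, if x = r then ((g p j * g r w) ⊗ₜ[K] (g k q * g w s)) ⊗ₜ[K]
        (antipode K (g i p) * g q l * g s y) else 0) =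
        if x = r then (∑ q, ∑ s, ((g p j * g r w) ⊗ₜ[K] (g k q * g w s)) ⊗ₜ[K]
        (antipode K (g i p) * g q l * g s y)) else 0 := by
      intro w p r
      split_ifs <;> simp
    simp only [hr, Finset.sum_ite_eq, Finset.mem_univ, if_true]
    -- LHS: sum w p q s ; RHS sum over some order
    simp only [TensorProduct.map_tmul, actV_apply, hg.cm, Finset.mul_sum, sum_tmul,
      Algebra.TensorProduct.tmul_mul_tmul, LinearMap.mul_apply']
    have e2 : ∀ F : κ → κ → κ → κ → (H ⊗[K] H) ⊗[K] H,
        ∑ w, ∑ p, ∑ q, ∑ s, F w p q s = ∑ s, ∑ p, ∑ q, ∑ w, F w p q s := by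
      intro F
      calc _ = ∑ w, ∑ t : κ × κ × κ, F w t.1 t.2.1 t.2.2 := by simp only [Fintype.sum_prod_type]
        _ = ∑ t : κ × κ × κ, ∑ w, F w t.1 t.2.1 t.2.2 := Finset.sum_comm
        _ = ∑ t : κ × κ, ∑ s, ∑ w, F w t.1 t.2 s := by simp only [Fintype.sum_prod_type]
        _ = ∑ s, ∑ t : κ × κ, ∑ w, F w t.1 t.2 s := Finset.sum_comm
        _ = _ := by simp only [Fintype.sum_prod_type]
    exact e2 _
  intro v x
  have h1 := ext_coef (K := K) hs (f := TensorProduct.lift (LinearMap.mk₂ K (fun y z => (LinearMap.mulLeft K y).lTensor (H ⊗[K] H) (coactV K H (actV K H v z)))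
    (fun y y' z => by rw [← LinearMap.add_apply, ← LinearMap.lTensor_add]; congr 2; ext; simp [add_mul])
    (fun c y z => by rw [← LinearMap.smul_apply, ← LinearMap.lTensor_smul]; congr 2; ext; simp)
    (fun y z z' => by simp) (fun c y z => by simp)) ∘ₗ comul (R := K) (A := H))
    (f' := TensorProduct.map₂ (actV K H) (LinearMap.mul K H) (coactV K H v) ∘ₗ comul (R := K) (A := H)) (by
      intro i j
      have := LinearMap.congr_fun (main i j) v
      simpa [hg.cm] using this)
  exact LinearMap.congr_fun h1 x
end

theorem algclosed_main [IsAlgClosed K] [FiniteDimensional K H] (p : ℕ) [Fact p.Prime] [CharP K p]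
    (Sinv : H →ₗ[K] H)
    (hS1 : Sinv ∘ₗ antipode (R := K) (A := H) = LinearMap.id)
    (hS2 : antipode (R := K) (A := H) ∘ₗ Sinv = LinearMap.id) :
    ∃ N : ℕ, 0 < N ∧ expMap K H Sinv N = counitUnit K H := by
  obtain ⟨g, hg, he, hs⟩ := exists_span_coef' K H
  have hnt : Nontrivial (H ⊗[K] H) := by
    refine nontrivial_of_ne (1 : H ⊗[K] H) 0 fun h0 => ?_
    have := congrArg (LinearMap.mul' K K ∘ₗ TensorProduct.map (counit (R := K) (A := H)) (counit (R := K) (A := H))) h0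
    rw [Algebra.TensorProduct.one_def] at this
    simp at this
  obtain ⟨N, hN, h⟩ := yd_finite p (isYD_V hg hs) isAct_actV (isCoact_coactV hg hs) Sinv hS1 hS2
  refine ⟨N, hN, ?_⟩
  have hSi : Function.Injective Sinv := Function.LeftInverse.injective (S_Sinv Sinv hS1 hS2)
  have hid : (counit (R := K) (A := H)).lTensor H ∘ₗ comul (R := K) = (TensorProduct.mk K H K).flip 1 := by
    ext x; simp
  -- the projection H ⊗ H → H
  let π : H ⊗[K] H →ₗ[K] H := (TensorProduct.rid K H).toLinearMap ∘ₗ (counit (R := K) (A := H)).lTensor H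
  have hπ : ∀ (m x : H), π (((1:H) ⊗ₜ[K] m) * comul (R := K) x) = counit (R := K) m • x := by
    intro m x
    have h1 : ∀ t : H ⊗[K] H, π (((1:H) ⊗ₜ[K] m) * t) = counit (R := K) m • π t := by
      intro t
      induction t using TensorProduct.induction_on with
      | zero => simp
      | tmul p q => simp [π, mul_smul]
      | add p q hp hq => rw [mul_add, map_add, hp, hq, map_add, smul_add]
    rw [h1]
    simp [π]
  have hone : comul (R := K) (1:H) = ∑ _i : Unit, (1:H) ⊗ₜ[K] (1:H) := by
    simp [Algebra.TensorProduct.one_def]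
  have hkey : ∀ x : H, (Sinv ∘ₗ Sinv) (expMap K H Sinv N x) = counit (R := K) x • 1 := by
    have : ((Sinv ∘ₗ Sinv) ∘ₗ expMap K H Sinv N) = (LinearMap.toSpanSingleton K H 1) ∘ₗ counit (R := K) (A := H) := by
      apply ext_coef hs
      intro i j
      have h2 := congrArg π (h ((1:H) ⊗ₜ g i j))
      rw [coactV_tmul hone (hg.cm i j)] at h2
      simp only [Finset.univ_unique, Finset.sum_singleton, map_sum, LinearMap.lTensor_tmul, TensorProduct.lift.tmul,
        actV_apply, hπ, antipode_one, one_mul, hg.cu] at h2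
      simp only [ite_smul, one_smul, zero_smul, Finset.sum_ite_eq, Finset.mem_univ, if_true] at h2
      rw [h2]
      simp [π, hg.cu]
    exact fun x => LinearMap.congr_fun this x
  ext x
  apply hSi
  apply hSi
  have := hkey x
  simp only [LinearMap.comp_apply] at this
  rw [this, counitUnit, LinearMap.comp_apply, Algebra.linearMap_apply, Algebra.algebraMap_eq_smul_one, map_smul,
    map_smul, Sinv_one Sinv hS1 hS2, Sinv_one Sinv hS1 hS2]
end H4


section H5
open Coalgebra HopfAlgebra

theorem conv_bc {k H K : Type*} [Field k] [Ring H] [HopfAlgebra k H] [Field K] [Algebra k K]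
    (f g : H →ₗ[k] H) : conv K (K ⊗[k] H) (f.baseChange K) (g.baseChange K) = (conv k H f g).baseChange K := by
  apply TensorProduct.AlgebraTensorModule.ext
  intro a h
  obtain ⟨ι, s, x, y, e⟩ : ∃ (ι : Type _) (s : Finset ι) (x y : ι → H), comul (R := k) h = ∑ i ∈ s, x i ⊗ₜ y i := by
    let r := Coalgebra.Repr.arbitrary k h
    exact ⟨_, r.index, r.left, r.right, r.eq.symm⟩
  simp [conv, e, TensorProduct.comul_tmul, tmul_sum, map_sum]

theorem expMap_bc {k H K : Type*} [Field k] [Ring H] [HopfAlgebra k H] [Field K] [Algebra k K]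
    (T : H →ₗ[k] H) : ∀ n, expMap K (K ⊗[k] H) (T.baseChange K) n = (expMap k H T n).baseChange K
  | 0 => by simp [expMap]
  | 1 => by simp [expMap]
  | (n+2) => by
    rw [expMap, expMap, expMap_bc T (n+1), ← conv_bc, ← LinearMap.baseChange_comp, LinearMap.baseChange_pow]

theorem counitUnit_bc {k H K : Type*} [Field k] [Ring H] [HopfAlgebra k H] [Field K] [Algebra k K] :
    counitUnit K (K ⊗[k] H) = (counitUnit k H).baseChange K := by
  apply TensorProduct.AlgebraTensorModule.ext
  intro a h
  simp [counitUnit, TensorProduct.counit_tmul, Algebra.algebraMap_eq_smul_one, smul_tmul', Algebra.TensorProduct.one_def]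

theorem antipode_bc {k H K : Type*} [Field k] [Ring H] [HopfAlgebra k H] [Field K] [Algebra k K] :
    antipode K (A := K ⊗[k] H) = (antipode k (A := H)).baseChange K := by
  apply TensorProduct.AlgebraTensorModule.ext
  intro a h
  simp [TensorProduct.antipode_def]

theorem exists_exp {k H : Type*} [Field k] [Ring H] [HopfAlgebra k H]
    [FiniteDimensional k H] (p : ℕ) (hp : p ≠ 0) [CharP k p]
    (Sinv : H →ₗ[k] H)
    (hS1 : Sinv ∘ₗ HopfAlgebra.antipode (R := k) (A := H) = LinearMap.id)
    (hS2 : HopfAlgebra.antipode (R := k) (A := H) ∘ₗ Sinv = LinearMap.id) :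
    ∃ N, 0 < N ∧ expMap k H Sinv N = counitUnit k H := by
  let K := AlgebraicClosure k
  haveI : Fact p.Prime := ⟨(CharP.char_is_prime_or_zero k p).resolve_right hp⟩
  haveI : CharP K p := charP_of_injective_algebraMap (algebraMap k K).injective p
  obtain ⟨N, hN, h⟩ := algclosed_main (K := K) (H := K ⊗[k] H) p (Sinv.baseChange K)
    (by rw [antipode_bc, ← LinearMap.baseChange_comp, hS1, LinearMap.baseChange_id])
    (by rw [antipode_bc, ← LinearMap.baseChange_comp, hS2, LinearMap.baseChange_id])
  refine ⟨N, hN, ?_⟩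
  rw [expMap_bc, counitUnit_bc] at h
  ext x
  have := LinearMap.congr_fun h (1 ⊗ₜ x)
  simp only [LinearMap.baseChange_tmul] at this
  exact Algebra.TensorProduct.includeRight_injective (R := k) (A := K) (B := H) (algebraMap k K).injective this

end H5

/-- Over a field of positive characteristic `p`, every finite-dimensional Hopf algebra with
bijective antipode has finite exponent. -/
theorem hopfExponent_ne_zero_of_charP {k H : Type*} [Field k] [Ring H] [HopfAlgebra k H]
    [FiniteDimensional k H] (p : ℕ) (hp : p ≠ 0) [CharP k p]
    (Sinv : H →ₗ[k] H)
    (hS1 : Sinv ∘ₗ HopfAlgebra.antipode (R := k) (A := H) = LinearMap.id)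
    (hS2 : HopfAlgebra.antipode (R := k) (A := H) ∘ₗ Sinv = LinearMap.id) :
    hopfExponent k H Sinv ≠ 0 := by
  obtain ⟨N, hN⟩ := exists_exp p hp Sinv hS1 hS2
  have h := Nat.sInf_mem (s := {n : ℕ | 0 < n ∧ expMap k H Sinv n = counitUnit k H}) ⟨N, hN⟩
  exact h.1.ne'

end
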